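/- arXiv:2109.01597 — 2 statements merged into one kernel-verified Lean document; each statement's English description precedes it below -/
import Mathlib

section
/- There exists an absolute constant C > 0 such that for every integer m ≥ 3 there is a positive integer γ with γ ≤ C·(m−2)³ having the property: every m-gonal form (with any number of variables and any positive integer coefficients) that represents over ℕ₀ each of the integers 1, 2, …, γ represents every positive integer over ℕ₀ (i.e., is universal over ℕ₀). -/
/-- The `x`-th `m`-gonal number `P_m(x) = ((m-2)/2)(x² - x) + x`.
Since `x * (x - 1)` is always even, the integer division by `2` is exact. -/
def polyNum (m x : ℤ) : ℤ := (m - 2) * (x * (x - 1)) / 2 + x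


/-- Hensel lifting of square roots. -/
lemma hs_odd (p : ℕ) (hp : p.Prime) (h2 : p ≠ 2) (w y0 : ℤ) (hw : ¬ (p : ℤ) ∣ w)
    (h0 : (p : ℤ) ∣ y0 ^ 2 - w) (E : ℕ) : ∃ y : ℤ, (p : ℤ) ^ (E + 1) ∣ y ^ 2 - w := by
  have hpz : Prime (p : ℤ) := Nat.prime_iff_prime_int.mp hp
  induction E with
  | zero => exact ⟨y0, by simpa using h0⟩
  | succ E ih =>
    obtain ⟨y, h, hy⟩ := ih
    have hyp : ¬ (p : ℤ) ∣ 2 * y := by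
      intro hd
      rcases hpz.dvd_or_dvd hd with h' | h'
      · have : p ∣ 2 := by exact_mod_cast h'
        exact h2 ((Nat.prime_dvd_prime_iff_eq hp Nat.prime_two).mp this)
      · apply hw
        have e : w = y ^ 2 - (p : ℤ) ^ (E + 1) * h := by linarith
        rw [e]
        exact dvd_sub (dvd_pow h' two_ne_zero) (Dvd.dvd.mul_right (dvd_pow_self _ (by omega)) _)
    have hc : IsCoprime (p : ℤ) (2 * y) := (Prime.coprime_iff_not_dvd hpz).mpr hyp
    obtain ⟨u, v, huv⟩ := hc
    refine ⟨y + p ^ (E + 1) * (- h * v), ?_⟩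
    have : (y + (p : ℤ) ^ (E + 1) * (- h * v)) ^ 2 - w
        = (p : ℤ) ^ (E + 1 + 1) * (h * u + (p : ℤ) ^ E * (h * v) ^ 2) := by
      have e1 : y ^ 2 = w + (p : ℤ) ^ (E + 1) * h := by linarith
      have e2 : h * (2 * y * v) = h * (1 - u * p) := by rw [← huv]; ring
      calc (y + (p : ℤ) ^ (E + 1) * (- h * v)) ^ 2 - w
          = y ^ 2 - w - (p : ℤ) ^ (E + 1) * (h * (2 * y * v)) + ((p : ℤ) ^ (E + 1) * (h * v)) ^ 2 := by ring
        _ = (p : ℤ) ^ (E + 1) * h - (p : ℤ) ^ (E + 1) * (h * (1 - u * p))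
            + ((p : ℤ) ^ (E + 1) * (h * v)) ^ 2 := by rw [e1, e2]; ring
        _ = _ := by ring
    rw [this]; exact dvd_mul_right _ _

lemma hs_two (w y0 : ℤ) (hw : ¬ (2 : ℤ) ∣ w)
    (h0 : (8 : ℤ) ∣ y0 ^ 2 - w) (E : ℕ) : ∃ y : ℤ, (2 : ℤ) ^ (E + 3) ∣ y ^ 2 - w := by
  induction E with
  | zero => exact ⟨y0, by simpa using h0⟩
  | succ E ih =>
    obtain ⟨y, h, hy⟩ := ih
    have hyo : Odd y := by
      by_contra hne
      rw [Int.not_odd_iff_even] at hne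
      apply hw
      have e : w = y ^ 2 - 2 * ((2 : ℤ) ^ (E + 2) * h) := by
        have : (2 : ℤ) ^ (E + 3) = 2 * 2 ^ (E + 2) := by ring
        rw [this] at hy; linarith
      rw [e]
      exact dvd_sub (dvd_pow hne.two_dvd two_ne_zero) (dvd_mul_right _ _)
    obtain ⟨z, hz⟩ := hyo
    refine ⟨y + 2 ^ (E + 2) * h, ?_⟩
    have : (y + (2 : ℤ) ^ (E + 2) * h) ^ 2 - w
        = (2 : ℤ) ^ (E + 1 + 3) * (h * (z + 1) + 2 ^ E * h ^ 2) := by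
      calc (y + (2 : ℤ) ^ (E + 2) * h) ^ 2 - w
          = (y ^ 2 - w) + (2 : ℤ) ^ (E + 3) * h * y + ((2 : ℤ) ^ (E + 2) * h) ^ 2 := by ring
        _ = _ := by rw [hy, hz]; ring
    rw [this]; exact dvd_mul_right _ _

lemma hs (p : ℕ) (hp : p.Prime) (w y0 : ℤ) (hw : ¬ (p : ℤ) ∣ w)
    (h0 : (p : ℤ) ^ 3 ∣ y0 ^ 2 - w) (E : ℕ) : ∃ y : ℤ, (p : ℤ) ^ E ∣ y ^ 2 - w := by
  by_cases h2 : p = 2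
  · subst h2
    obtain ⟨y, hy⟩ := hs_two w y0 (by simpa using hw) (by simpa using h0) E
    exact ⟨y, (pow_dvd_pow _ (by omega : E ≤ E + 3)).trans (by exact_mod_cast hy)⟩
  · obtain ⟨y, hy⟩ := hs_odd p hp h2 w y0 hw (dvd_trans (dvd_pow_self _ (by norm_num)) h0) E
    exact ⟨y, dvd_trans (pow_dvd_pow _ (by omega)) hy⟩

/-- inverse modulo a prime power -/
lemma inv_pp (p : ℕ) (hp : p.Prime) (a : ℤ) (ha : ¬ (p : ℤ) ∣ a) (e : ℕ) (t : ℤ) :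
    ∃ x : ℕ, (p : ℤ) ^ e ∣ a * x - t := by
  have hpz : Prime (p : ℤ) := Nat.prime_iff_prime_int.mp hp
  have hc : IsCoprime ((p : ℤ) ^ e) a := ((Prime.coprime_iff_not_dvd hpz).mpr ha).pow_left
  obtain ⟨u, v, huv⟩ := hc
  have hpos : (0 : ℤ) < (p : ℤ) ^ e := by have := hp.pos; positivity
  refine ⟨((v * t) % (p : ℤ) ^ e).toNat, ?_⟩
  rw [Int.toNat_of_nonneg (Int.emod_nonneg _ hpos.ne')]
  have : v * t % (p : ℤ) ^ e = v * t - (p : ℤ) ^ e * (v * t / (p : ℤ) ^ e) := by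
    rw [Int.emod_def]
  rw [this]
  refine ⟨- u * t - a * (v * t / (p : ℤ) ^ e), ?_⟩
  linear_combination t * huv

/-- from `p^4`-covering to covering modulo all powers -/
lemma qc {κ : Type*} [Fintype κ] [DecidableEq κ] (p : ℕ) (hp : p.Prime) (a : κ → ℕ)
    (h4 : ∀ T : ℤ, ∃ y : κ → ℤ, (p : ℤ) ^ 4 ∣ ∑ i, (a i : ℤ) * y i ^ 2 - T) (e : ℕ) :
    ∀ T : ℤ, ∃ y : κ → ℤ, (p : ℤ) ^ e ∣ ∑ i, (a i : ℤ) * y i ^ 2 - T := by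
  have hpz : Prime (p : ℤ) := Nat.prime_iff_prime_int.mp hp
  induction e using Nat.strong_induction_on with
  | _ e ih =>
  intro T
  by_cases he : e ≤ 4
  · obtain ⟨y, hy⟩ := h4 T
    exact ⟨y, dvd_trans (pow_dvd_pow _ he) hy⟩
  by_cases hT : (p : ℤ) ^ 2 ∣ T
  · obtain ⟨T', rfl⟩ := hT
    obtain ⟨y, hy⟩ := ih (e - 2) (by omega) T'
    refine ⟨fun i => p * y i, ?_⟩
    have e1 : ∑ i, (a i : ℤ) * (p * y i) ^ 2 - p ^ 2 * T'
        = (p : ℤ) ^ 2 * (∑ i, (a i : ℤ) * y i ^ 2 - T') := by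
      rw [mul_sub, Finset.mul_sum]; congr 1
      exact Finset.sum_congr rfl fun i _ => by ring
    rw [e1]
    have e2 : (p : ℤ) ^ e = (p : ℤ) ^ 2 * (p : ℤ) ^ (e - 2) := by
      rw [← pow_add]; congr 1; omega
    rw [e2]
    exact mul_dvd_mul_left _ hy
  · obtain ⟨y, h, hy⟩ := h4 T
    have : ∃ i, ¬ (p : ℤ) ^ 2 ∣ (a i : ℤ) * y i ^ 2 := by
      by_contra hcon
      push Not at hcon
      apply hT
      have e1 : T = ∑ i, (a i : ℤ) * y i ^ 2 - (p : ℤ) ^ 2 * ((p : ℤ) ^ 2 * h) := by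
        have : (p : ℤ) ^ 4 = p ^ 2 * p ^ 2 := by ring
        rw [this] at hy; linarith
      rw [e1]
      exact dvd_sub (Finset.dvd_sum fun i _ => hcon i) (dvd_mul_right _ _)
    obtain ⟨i, hi⟩ := this
    have hyi : ¬ (p : ℤ) ∣ y i := fun hd => hi (Dvd.dvd.mul_left (pow_dvd_pow_of_dvd hd 2) _)
    have : ∃ (δ : ℕ) (a' : ℤ), δ ≤ 1 ∧ (a i : ℤ) = p ^ δ * a' ∧ ¬ (p : ℤ) ∣ a' := by
      by_cases hd : (p : ℤ) ∣ a i
      · obtain ⟨a', ha'⟩ := hd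
        refine ⟨1, a', le_refl _, by simpa using ha', ?_⟩
        rintro ⟨a'', rfl⟩
        exact hi ⟨a'' * y i ^ 2, by rw [ha']; ring⟩
      · exact ⟨0, a i, by norm_num, by simp, hd⟩
    obtain ⟨δ, a', hδ, hai, ha'⟩ := this
    -- target for the unit part
    set t : ℤ := a' * y i ^ 2 - (p : ℤ) ^ (4 - δ) * h with ht
    have hpt : ¬ (p : ℤ) ∣ a' * t := by
      intro hd
      rcases hpz.dvd_or_dvd hd with h' | h'
      · exact ha' h'
      · have h3 : (p : ℤ) ∣ a' * y i ^ 2 := by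
          have : a' * y i ^ 2 = t + (p : ℤ) ^ (4 - δ) * h := by rw [ht]; ring
          rw [this]
          exact dvd_add h' (Dvd.dvd.mul_right (dvd_pow_self _ (by omega)) _)
        rcases hpz.dvd_or_dvd h3 with h' | h'
        · exact ha' h'
        · exact hyi (hpz.dvd_of_dvd_pow h')
    obtain ⟨z, hz⟩ := hs p hp (a' * t) (a' * y i) hpt (by
      have : (a' * y i) ^ 2 - a' * t = (p : ℤ) ^ (4 - δ) * (a' * h) := by rw [ht]; ring
      rw [this]
      exact Dvd.dvd.mul_right (pow_dvd_pow _ (by omega)) _) e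
    obtain ⟨x, hx⟩ := inv_pp p hp a' ha' e z
    refine ⟨Function.update y i x, ?_⟩
    have hsum : ∀ g : κ → ℤ, ∑ j, (a j : ℤ) * g j ^ 2
        = (a i : ℤ) * g i ^ 2 + ∑ j ∈ Finset.univ.erase i, (a j : ℤ) * g j ^ 2 :=
      fun g => (Finset.add_sum_erase _ _ (Finset.mem_univ i)).symm
    have hrest : ∑ j ∈ Finset.univ.erase i, (a j : ℤ) * (Function.update y i (x : ℤ)) j ^ 2
        = ∑ j ∈ Finset.univ.erase i, (a j : ℤ) * y j ^ 2 :=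
      Finset.sum_congr rfl fun j hj => by
        rw [Function.update_of_ne (Finset.ne_of_mem_erase hj)]
    rw [hsum, hrest, Function.update_self]
    have e3 : ∑ j ∈ Finset.univ.erase i, (a j : ℤ) * y j ^ 2 - T = - (p : ℤ) ^ δ * t := by
      have h5 := hy
      rw [hsum y, hai] at h5
      have h6 : (p : ℤ) ^ 4 = p ^ δ * p ^ (4 - δ) := by rw [← pow_add]; congr 1; omega
      rw [h6] at h5
      rw [ht]; linear_combination h5
    have e4 : (a i : ℤ) * (x : ℤ) ^ 2 + ∑ j ∈ Finset.univ.erase i, (a j : ℤ) * y j ^ 2 - T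
        = (p : ℤ) ^ δ * (a' * (x : ℤ) ^ 2 - t) := by
      rw [hai]; linear_combination e3
    rw [e4]
    apply Dvd.dvd.mul_left
    have hc : IsCoprime ((p : ℤ) ^ e) a' := ((Prime.coprime_iff_not_dvd hpz).mpr ha').pow_left
    apply hc.dvd_of_dvd_mul_left
    have e5 : a' * (a' * (x : ℤ) ^ 2 - t) = (a' * x - z) * (a' * x + z) + (z ^ 2 - a' * t) := by ring
    rw [e5]
    exact dvd_add (Dvd.dvd.mul_right hx _) hz

lemma three_units {κ : Type*} [Fintype κ] [DecidableEq κ] (p : ℕ) (hp : p.Prime) (h2 : p ≠ 2)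
    (a : κ → ℕ) (i1 i2 i3 : κ) (h12 : i1 ≠ i2) (h13 : i1 ≠ i3) (h23 : i2 ≠ i3)
    (ha1 : ¬ p ∣ a i1) (ha2 : ¬ p ∣ a i2) (ha3 : ¬ p ∣ a i3) (e : ℕ) :
    ∀ T : ℤ, ∃ y : κ → ℤ, (p : ℤ) ^ e ∣ ∑ i, (a i : ℤ) * y i ^ 2 - T := by
  intro T
  have hpz : Prime (p : ℤ) := Nat.prime_iff_prime_int.mp hp
  have : Fact p.Prime := ⟨hp⟩
  have : ∃ x y : ℤ, (p : ℤ) ∣ a i1 * x ^ 2 + a i2 * y ^ 2 - (T - a i3) := by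
    open Polynomial in
    have n1 : ((a i1 : ℕ) : ZMod p) ≠ 0 := by rwa [Ne, ZMod.natCast_eq_zero_iff]
    have n2 : ((a i2 : ℕ) : ZMod p) ≠ 0 := by rwa [Ne, ZMod.natCast_eq_zero_iff]
    let f : Polynomial (ZMod p) := Polynomial.C (a i1 : ZMod p) * Polynomial.X ^ 2
    let g : Polynomial (ZMod p) := Polynomial.C (a i2 : ZMod p) * Polynomial.X ^ 2 + Polynomial.C (0 : ZMod p) * Polynomial.X
      + Polynomial.C (((a i3 : ℤ) - T : ℤ) : ZMod p)
    have hf : f.degree = 2 := by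
      simpa [f] using Polynomial.degree_C_mul_X_pow 2 n1
    have hg : g.degree = 2 := Polynomial.degree_quadratic n2
    obtain ⟨x, y, hxy⟩ := FiniteField.exists_root_sum_quadratic hf hg (by
      rw [ZMod.card]; exact (hp.eq_two_or_odd.resolve_left h2))
    refine ⟨x.val, y.val, ?_⟩
    rw [← ZMod.intCast_zmod_eq_zero_iff_dvd _ p]
    simp [f, g] at hxy
    push_cast
    simp
    linear_combination hxy
  obtain ⟨x, y, h, hxy⟩ := this
  have ha3' : ¬ (p : ℤ) ∣ (a i3 : ℤ) := by exact_mod_cast ha3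
  set t : ℤ := T - a i1 * x ^ 2 - a i2 * y ^ 2 with ht
  have ht' : t = a i3 - p * h := by rw [ht]; linarith
  have hpt : ¬ (p : ℤ) ∣ a i3 * t := by
    intro hd
    rcases hpz.dvd_or_dvd hd with h' | h'
    · exact ha3' h'
    · apply ha3'
      have : (a i3 : ℤ) = t + p * h := by linarith
      rw [this]; exact dvd_add h' (dvd_mul_right _ _)
  obtain ⟨z, hz⟩ := hs_odd p hp h2 (a i3 * t) (a i3) hpt ⟨a i3 * h, by rw [ht']; ring⟩ e
  have hz : (p : ℤ) ^ e ∣ z ^ 2 - a i3 * t := dvd_trans (pow_dvd_pow _ (by omega)) hz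
  obtain ⟨u, hu⟩ := inv_pp p hp (a i3) ha3' e z
  refine ⟨fun i => if i = i1 then x else if i = i2 then y else if i = i3 then u else 0, ?_⟩
  have : ∑ i, (a i : ℤ) * (if i = i1 then x else if i = i2 then y else if i = i3 then (u : ℤ) else 0) ^ 2
      = a i1 * x ^ 2 + a i2 * y ^ 2 + a i3 * (u : ℤ) ^ 2 := by
    rw [← Finset.sum_subset (Finset.subset_univ ({i1, i2, i3} : Finset κ))]
    · rw [Finset.sum_insert (by simp [h12, h13]), Finset.sum_insert (by simp [h23]),
        Finset.sum_singleton]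
      simp [h12.symm, h13.symm, h23.symm, add_assoc]
    · intro i _ hi
      simp at hi
      simp [hi.1, hi.2.1, hi.2.2]
  rw [this]
  have e4 : (a i1 : ℤ) * x ^ 2 + a i2 * y ^ 2 + a i3 * (u : ℤ) ^ 2 - T = a i3 * (u : ℤ) ^ 2 - t := by
    rw [ht]; ring
  rw [e4]
  have hc : IsCoprime ((p : ℤ) ^ e) (a i3 : ℤ) := ((Prime.coprime_iff_not_dvd hpz).mpr ha3').pow_left
  apply hc.dvd_of_dvd_mul_left
  have e5 : (a i3 : ℤ) * (a i3 * (u : ℤ) ^ 2 - t) = (a i3 * u - z) * (a i3 * u + z) + (z ^ 2 - a i3 * t) := by ring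
  rw [e5]
  exact dvd_add (Dvd.dvd.mul_right hu _) hz

/-- `m`-gonal number with `k = m - 2`, over the naturals -/
def PP (k x : ℕ) : ℕ := k * x.choose 2 + x

/-- twice the `m`-gonal number -/
def GG (k x : ℤ) : ℤ := k * (x * (x - 1)) + 2 * x

lemma choose_two_cast (x : ℕ) : 2 * ((x.choose 2 : ℕ) : ℤ) = (x : ℤ) * (x - 1) := by
  induction x with
  | zero => simp
  | succ n ih =>
    rw [Nat.choose_succ_succ' n 1, Nat.choose_one_right]; push_cast; linarith

lemma two_PP (k x : ℕ) : 2 * ((PP k x : ℕ) : ℤ) = GG k x := by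
  unfold PP GG
  push_cast
  linear_combination (k : ℤ) * choose_two_cast x

lemma GG_congr (k x y R : ℤ) (h : R ∣ x - y) : R ∣ GG k x - GG k y := by
  have : GG k x - GG k y = (x - y) * (k * (x + y - 1) + 2) := by unfold GG; ring
  rw [this]; exact Dvd.dvd.mul_right h _

/-- a map with `f x - f y = (x - y) * unit` is onto modulo prime powers -/
lemma surj_pp (p : ℕ) (hp : p.Prime) (f : ℤ → ℤ) (u : ℤ → ℤ → ℤ)
    (hf : ∀ x y, f x - f y = (x - y) * u x y) (hu : ∀ x y, ¬ (p : ℤ) ∣ u x y) (e : ℕ) (N : ℤ) :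
    ∃ x : ℕ, (p : ℤ) ^ e ∣ f x - N := by
  have hpz : Prime (p : ℤ) := Nat.prime_iff_prime_int.mp hp
  have hpos : 0 < p ^ e := pow_pos hp.pos _
  have : NeZero (p ^ e) := ⟨hpos.ne'⟩
  let F : ZMod (p ^ e) → ZMod (p ^ e) := fun z => ((f (z.val : ℤ) : ℤ) : ZMod (p ^ e))
  have hinj : Function.Injective F := by
    intro z w hzw
    have h1 : (((f z.val - f w.val : ℤ)) : ZMod (p ^ e)) = 0 := by
      push_cast; exact sub_eq_zero.mpr hzw
    rw [ZMod.intCast_zmod_eq_zero_iff_dvd, hf] at h1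
    have hc : IsCoprime (((p ^ e : ℕ)) : ℤ) (u z.val w.val) := by
      push_cast
      exact ((Prime.coprime_iff_not_dvd hpz).mpr (hu _ _)).pow_left
    have h2 := hc.dvd_of_dvd_mul_right h1
    rw [← ZMod.intCast_zmod_eq_zero_iff_dvd] at h2
    push_cast at h2
    simpa using sub_eq_zero.mp h2
  obtain ⟨z, hz⟩ := (Finite.injective_iff_surjective.mp hinj) (N : ZMod (p ^ e))
  refine ⟨z.val, ?_⟩
  have : (((f z.val - N : ℤ)) : ZMod (p ^ e)) = 0 := by
    push_cast; exact sub_eq_zero.mpr hz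
  rw [ZMod.intCast_zmod_eq_zero_iff_dvd] at this
  exact_mod_cast this

lemma PP_zero (k : ℕ) : PP k 0 = 0 := by simp [PP]

lemma GG_zero (k : ℤ) : GG k 0 = 0 := by simp [GG]

lemma single_sum {κ : Type*} [Fintype κ] [DecidableEq κ] (k : ℤ) (a : κ → ℕ) (i0 : κ) (h1 : a i0 = 1)
    (x : ℕ) : ∑ i, (a i : ℤ) * GG k ((Pi.single i0 x : κ → ℕ) i : ℕ) = GG k x := by
  rw [Finset.sum_eq_single i0]
  · simp [h1]
  · intro j _ hj; simp [Pi.single_eq_of_ne hj, GG_zero]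
  · simp

lemma sq_cov {κ : Type*} [Fintype κ] [DecidableEq κ] (k : ℕ) (a : κ → ℕ) (p : ℕ) (hp : p.Prime)
    (l mu nu : ℤ) (hl : ¬ (p : ℤ) ∣ l) (hmu : ¬ (p : ℤ) ∣ mu)
    (hid : ∀ x : ℕ, l * (PP k x : ℕ) = (mu * x - nu) ^ 2 - nu ^ 2)
    (hq : (∀ T : ℤ, ∃ y : κ → ℤ, (p : ℤ) ^ 4 ∣ ∑ i, (a i : ℤ) * y i ^ 2 - T) →
      ∀ e, ∀ T : ℤ, ∃ y : κ → ℤ, (p : ℤ) ^ e ∣ ∑ i, (a i : ℤ) * y i ^ 2 - T)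
    (hrep : (∀ e, ∀ T : ℤ, ∃ y : κ → ℤ, (p : ℤ) ^ e ∣ ∑ i, (a i : ℤ) * y i ^ 2 - T) ∨
      ∀ N : ℕ, 1 ≤ N → N ≤ p ^ 4 → ∃ x : κ → ℕ, ∑ i, a i * PP k (x i) = N) (e : ℕ) (N : ℤ) :
    ∃ x : κ → ℕ, (p : ℤ) ^ e ∣ ∑ i, (a i : ℤ) * (PP k (x i) : ℕ) - N := by
  have hpz : Prime (p : ℤ) := Nat.prime_iff_prime_int.mp hp
  have key : ∀ x : κ → ℕ, l * ∑ i, (a i : ℤ) * (PP k (x i) : ℕ)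
      = ∑ i, (a i : ℤ) * (mu * x i - nu) ^ 2 - (∑ i, (a i : ℤ)) * nu ^ 2 := by
    intro x
    rw [Finset.mul_sum, Finset.sum_mul, ← Finset.sum_sub_distrib]
    exact Finset.sum_congr rfl fun i _ => by linear_combination (a i : ℤ) * hid (x i)
  have hall : ∀ e, ∀ T : ℤ, ∃ y : κ → ℤ, (p : ℤ) ^ e ∣ ∑ i, (a i : ℤ) * y i ^ 2 - T := by
    rcases hrep with h | hrep
    · exact h
    apply hq
    intro T
    obtain ⟨n, hn⟩ := inv_pp p hp l hl 4 (T - (∑ i, (a i : ℤ)) * nu ^ 2)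
    have hpos : 0 < p ^ 4 := pow_pos hp.pos _
    -- reduce n into [1, p^4]
    obtain ⟨n', h1, h2, h3⟩ : ∃ n' : ℕ, 1 ≤ n' ∧ n' ≤ p ^ 4 ∧ (p : ℤ) ^ 4 ∣ (n' : ℤ) - n := by
      by_cases h0 : n % p ^ 4 = 0
      · refine ⟨p ^ 4, hpos, le_refl _, ?_⟩
        push_cast
        exact dvd_sub_self_left.mpr (by exact_mod_cast Nat.dvd_of_mod_eq_zero h0)
      · refine ⟨n % p ^ 4, Nat.pos_of_ne_zero h0, (Nat.mod_lt _ hpos).le, ?_⟩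
        push_cast
        exact ⟨-((n : ℤ) / p ^ 4), by rw [Int.emod_def]; ring⟩
    obtain ⟨x, hx⟩ := hrep n' h1 h2
    refine ⟨fun i => mu * x i - nu, ?_⟩
    have h4 := key x
    have h5 : ∑ i, (a i : ℤ) * (PP k (x i) : ℕ) = (n' : ℤ) := by exact_mod_cast hx
    rw [h5] at h4
    have : ∑ i, (a i : ℤ) * (mu * x i - nu) ^ 2 - T
        = l * ((n' : ℤ) - n) + (l * n - (T - (∑ i, (a i : ℤ)) * nu ^ 2)) := by linarith
    rw [this]
    exact dvd_add (Dvd.dvd.mul_left h3 _) hn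
  obtain ⟨y, hy⟩ := hall e (l * N + (∑ i, (a i : ℤ)) * nu ^ 2)
  choose x hx using fun i => inv_pp p hp mu hmu e (y i + nu)
  refine ⟨x, ?_⟩
  have hc : IsCoprime ((p : ℤ) ^ e) l := ((Prime.coprime_iff_not_dvd hpz).mpr hl).pow_left
  apply hc.dvd_of_dvd_mul_left
  rw [mul_sub, key]
  have : ∑ i, (a i : ℤ) * (mu * x i - nu) ^ 2 - (∑ i, (a i : ℤ)) * nu ^ 2 - l * N
      = ∑ i, (a i : ℤ) * ((mu * x i - (y i + nu)) * (mu * x i - nu + y i))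
        + (∑ i, (a i : ℤ) * y i ^ 2 - (l * N + (∑ i, (a i : ℤ)) * nu ^ 2)) := by
    have : ∑ i, (a i : ℤ) * (mu * x i - nu) ^ 2
        = ∑ i, (a i : ℤ) * ((mu * x i - (y i + nu)) * (mu * x i - nu + y i))
          + ∑ i, (a i : ℤ) * y i ^ 2 := by
      rw [← Finset.sum_add_distrib]
      exact Finset.sum_congr rfl fun i _ => by ring
    rw [this]; ring
  rw [this]
  refine dvd_add (Finset.dvd_sum fun i _ => ?_) hy
  exact Dvd.dvd.mul_left (Dvd.dvd.mul_right (hx i) _) _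

lemma cov_pp {κ : Type*} [Fintype κ] [DecidableEq κ] (k : ℕ) (a : κ → ℕ) (H : ℕ) (hH : 2 ≤ H)
    (i0 : κ) (h0 : a i0 = 1) (i1 i2 i3 : κ) (h12 : i1 ≠ i2) (h13 : i1 ≠ i3) (h23 : i2 ≠ i3)
    (hp1 : 0 < a i1 ∧ a i1 ≤ H) (hp2 : 0 < a i2 ∧ a i2 ≤ H) (hp3 : 0 < a i3 ∧ a i3 ≤ H)
    (hrep : ∀ N : ℕ, 1 ≤ N → N ≤ H ^ 4 → ∃ x : κ → ℕ, ∑ i, a i * PP k (x i) = N)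
    (p : ℕ) (hp : p.Prime) (e : ℕ) (N : ℤ) :
    ∃ x : κ → ℕ, (p : ℤ) ^ e ∣ ∑ i, (a i : ℤ) * GG k (x i) - 2 * N := by
  have hpz : Prime (p : ℤ) := Nat.prime_iff_prime_int.mp hp
  have fromP : (∃ x : κ → ℕ, (p : ℤ) ^ e ∣ ∑ i, (a i : ℤ) * (PP k (x i) : ℕ) - N) →
      ∃ x : κ → ℕ, (p : ℤ) ^ e ∣ ∑ i, (a i : ℤ) * GG k (x i) - 2 * N := by
    rintro ⟨x, hx⟩
    refine ⟨x, ?_⟩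
    have : ∑ i, (a i : ℤ) * GG k (x i) - 2 * N
        = 2 * (∑ i, (a i : ℤ) * (PP k (x i) : ℕ) - N) := by
      rw [mul_sub, Finset.mul_sum]; congr 1
      exact Finset.sum_congr rfl fun i _ => by rw [← two_PP]; ring
    rw [this]; exact Dvd.dvd.mul_left hx _
  by_cases h2 : p = 2
  · subst h2
    rcases Nat.even_or_odd k with hk | hk
    · obtain ⟨c, hc⟩ := hk
      rcases Nat.even_or_odd c with ⟨d, hd⟩ | ⟨h, hh⟩
      · -- 4 ∣ k
        obtain ⟨x, hx⟩ := surj_pp 2 hp (fun x => c * (x * (x - 1)) + x)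
          (fun x y => c * (x + y - 1) + 1) (fun x y => by ring) (fun x y => by
            rw [hd]; push_cast; rintro ⟨t, ht⟩
            have : (2 : ℤ) ∣ 1 := ⟨t - d * (x + y - 1), by linarith⟩
            norm_num at this) e N
        refine ⟨Pi.single i0 x, ?_⟩
        rw [single_sum _ _ _ h0]
        have : GG k x - 2 * N = 2 * ((c * (x * (x - 1)) + x : ℤ) - N) := by
          unfold GG; rw [hc]; push_cast; ring
        rw [this]; exact Dvd.dvd.mul_left hx _
      · -- k = 2 mod 4
        apply fromP
        refine sq_cov k a 2 hp c c h ?_ ?_ ?_ (fun h4 e => qc 2 hp a h4 e)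
          (Or.inr fun N h1 h2 => hrep N h1 (h2.trans (Nat.pow_le_pow_left hH 4))) e N
        · rw [hh]; push_cast; omega
        · rw [hh]; push_cast; omega
        · intro x
          have h6 := two_PP k x
          unfold GG at h6
          rw [hc] at h6 ⊢
          have h7 : (c : ℤ) = 2 * h + 1 := by rw [hh]; push_cast; ring
          push_cast at h6
          rw [h7] at h6 ⊢
          have h8 : (PP (c + c) x : ℤ) = (2 * h + 1) * (x * (x - 1)) + x := by linarith
          rw [h8]; ring
    · obtain ⟨h, hh⟩ := hk
      obtain ⟨x, hx⟩ := surj_pp 2 hp (fun w => w * (2 * k * w - (k - 2)))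
          (fun x y => 2 * k * (x + y) - (k - 2)) (fun x y => by ring) (fun x y => by
            rw [hh]; push_cast; rintro ⟨t, ht⟩
            have : (2 : ℤ) ∣ 1 := ⟨t - (2 * h + 1) * (x + y) + h, by linarith⟩
            norm_num at this) e N
      refine ⟨Pi.single i0 (2 * x), ?_⟩
      rw [single_sum _ _ _ h0]
      have : GG k ((2 * x : ℕ) : ℤ) - 2 * N = 2 * ((x : ℤ) * (2 * k * x - (k - 2)) - N) := by
        unfold GG; push_cast; ring
      rw [this]; exact Dvd.dvd.mul_left hx _
  · have hp2' : ¬ (p : ℤ) ∣ 2 := by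
      intro hd
      have : p ∣ 2 := by exact_mod_cast hd
      exact h2 ((Nat.prime_dvd_prime_iff_eq hp Nat.prime_two).mp this)
    by_cases hk : p ∣ k
    · obtain ⟨c, hc⟩ := hk
      obtain ⟨x, hx⟩ := surj_pp p hp (fun x => GG k x)
          (fun x y => k * (x + y - 1) + 2) (fun x y => by unfold GG; ring) (fun x y => by
            rw [hc]; push_cast; intro hd
            apply hp2'
            have : (2 : ℤ) = (p * c * (x + y - 1) + 2) - p * (c * (x + y - 1)) := by ring
            rw [this]; exact dvd_sub hd (dvd_mul_right _ _)) e (2 * N)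
      refine ⟨Pi.single i0 x, ?_⟩
      rw [single_sum _ _ _ h0]
      exact hx
    · apply fromP
      have hk' : ¬ (p : ℤ) ∣ k := by exact_mod_cast hk
      refine sq_cov k a p hp (8 * k) (2 * k) (k - 2) ?_ ?_ ?_ (fun h4 e => qc p hp a h4 e) ?_ e N
      · intro hd
        rcases hpz.dvd_or_dvd hd with h' | h'
        · have : (p : ℤ) ∣ 2 ^ 3 := by norm_num; exact h'
          exact hp2' (hpz.dvd_of_dvd_pow this)
        · exact hk' h'
      · intro hd
        rcases hpz.dvd_or_dvd hd with h' | h'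
        · exact hp2' h'
        · exact hk' h'
      · intro x
        have h6 := two_PP k x
        unfold GG at h6
        linear_combination 4 * (k : ℤ) * h6
      · by_cases hle : p ≤ H
        · exact Or.inr fun N h1 h2 => hrep N h1 (h2.trans (Nat.pow_le_pow_left hle 4))
        · left
          intro e
          have nd : ∀ t : ℕ, 0 < t ∧ t ≤ H → ¬ p ∣ t := fun t ht hd => by
            have := Nat.le_of_dvd ht.1 hd; omega
          exact three_units p hp h2 a i1 i2 i3 h12 h13 h23 (nd _ hp1) (nd _ hp2) (nd _ hp3) e

lemma crt_nat (R S : ℕ) (h : R.Coprime S) (x y : ℕ) :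
    ∃ z : ℕ, (R : ℤ) ∣ (z : ℤ) - x ∧ (S : ℤ) ∣ (z : ℤ) - y := by
  obtain ⟨z, h1, h2⟩ := Nat.chineseRemainder h x y
  exact ⟨z, (Nat.modEq_iff_dvd.mp h1.symm), (Nat.modEq_iff_dvd.mp h2.symm)⟩

lemma cov_all {κ : Type*} [Fintype κ] [DecidableEq κ] (k : ℕ) (a : κ → ℕ) (H : ℕ) (hH : 2 ≤ H)
    (i0 : κ) (h0 : a i0 = 1) (i1 i2 i3 : κ) (h12 : i1 ≠ i2) (h13 : i1 ≠ i3) (h23 : i2 ≠ i3)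
    (hp1 : 0 < a i1 ∧ a i1 ≤ H) (hp2 : 0 < a i2 ∧ a i2 ≤ H) (hp3 : 0 < a i3 ∧ a i3 ≤ H)
    (hrep : ∀ N : ℕ, 1 ≤ N → N ≤ H ^ 4 → ∃ x : κ → ℕ, ∑ i, a i * PP k (x i) = N)
    (R : ℕ) (hR : 0 < R) (N : ℤ) :
    ∃ x : κ → ℕ, (R : ℤ) ∣ ∑ i, (a i : ℤ) * GG k (x i) - 2 * N := by
  induction R using Nat.recOnPosPrimePosCoprime with
  | zero => omega
  | one => exact ⟨fun _ => 0, by simp⟩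
  | prime_pow p n hp _ =>
    obtain ⟨x, hx⟩ := cov_pp k a H hH i0 h0 i1 i2 i3 h12 h13 h23 hp1 hp2 hp3 hrep p hp n N
    exact ⟨x, by exact_mod_cast hx⟩
  | coprime r s hr hs hc ih1 ih2 =>
    obtain ⟨x, hx⟩ := ih1 (by omega)
    obtain ⟨y, hy⟩ := ih2 (by omega)
    choose z hz1 hz2 using fun i => crt_nat r s hc (x i) (y i)
    refine ⟨z, ?_⟩
    push_cast
    apply IsCoprime.mul_dvd (Nat.isCoprime_iff_coprime.mpr hc)
    · have : ∑ i, (a i : ℤ) * GG k (z i) - 2 * N = ∑ i, (a i : ℤ) * (GG k (z i) - GG k (x i))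
          + (∑ i, (a i : ℤ) * GG k (x i) - 2 * N) := by
        simp only [mul_sub, Finset.sum_sub_distrib]; ring
      rw [this]
      exact dvd_add (Finset.dvd_sum fun i _ => Dvd.dvd.mul_left (GG_congr _ _ _ _ (hz1 i)) _) hx
    · have : ∑ i, (a i : ℤ) * GG k (z i) - 2 * N = ∑ i, (a i : ℤ) * (GG k (z i) - GG k (y i))
          + (∑ i, (a i : ℤ) * GG k (y i) - 2 * N) := by
        simp only [mul_sub, Finset.sum_sub_distrib]; ring
      rw [this]
      exact dvd_add (Finset.dvd_sum fun i _ => Dvd.dvd.mul_left (GG_congr _ _ _ _ (hz2 i)) _) hy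

/-- units of the same square class modulo a prime -/
noncomputable def sqColor (p u : ℕ) : Fin 8 :=
  open Classical in
  if p = 2 then ⟨u % 8, Nat.mod_lt _ (by norm_num)⟩ else if IsSquare (u : ZMod p) then 1 else 0

lemma same_color (p : ℕ) (hp : p.Prime) (u U : ℕ) (hu : ¬ p ∣ u) (hU : ¬ p ∣ U)
    (h : sqColor p u = sqColor p U) (E : ℕ) : ∃ s : ℤ, (p : ℤ) ^ E ∣ u * s ^ 2 - U := by
  have hpz : Prime (p : ℤ) := Nat.prime_iff_prime_int.mp hp
  have huz : ¬ (p : ℤ) ∣ u := by exact_mod_cast hu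
  have hUz : ¬ (p : ℤ) ∣ U := by exact_mod_cast hU
  have hw : ¬ (p : ℤ) ∣ (u * U : ℤ) := fun hd => (hpz.dvd_or_dvd hd).elim huz hUz
  have hsq : ∃ y : ℤ, (p : ℤ) ^ E ∣ y ^ 2 - u * U := by
    by_cases h2 : p = 2
    · subst h2
      simp only [sqColor, if_true, Fin.mk.injEq] at h
      refine hs 2 hp (u * U) 1 hw ?_ E
      have hod : (u : ℤ) % 8 = (U : ℤ) % 8 := by omega
      have h3 : (U : ℤ) % 8 = 1 ∨ (U : ℤ) % 8 = 3 ∨ (U : ℤ) % 8 = 5 ∨ (U : ℤ) % 8 = 7 := by omega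
      have h4 : ((u : ℤ) * U) % 8 = 1 := by
        rw [Int.mul_emod, hod]
        rcases h3 with h | h | h | h <;> rw [h] <;> norm_num
      norm_num
      omega
    · have : Fact p.Prime := ⟨hp⟩
      have n1 : (u : ZMod p) ≠ 0 := by rwa [Ne, ZMod.natCast_eq_zero_iff]
      have n2 : (U : ZMod p) ≠ 0 := by rwa [Ne, ZMod.natCast_eq_zero_iff]
      have hiff : IsSquare (u : ZMod p) ↔ IsSquare (U : ZMod p) := by
        simp only [sqColor, if_neg h2] at h
        by_cases h1 : IsSquare (u : ZMod p) <;> by_cases h3 : IsSquare (U : ZMod p) <;>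
          simp [h1, h3] at h ⊢
      have hs2 : IsSquare ((u : ZMod p) * U) := by
        by_cases h1 : IsSquare (u : ZMod p)
        · exact h1.mul (hiff.mp h1)
        · have h3 : ¬ IsSquare (U : ZMod p) := fun h => h1 (hiff.mpr h)
          have q1 := (quadraticChar_neg_one_iff_not_isSquare (a := (u : ZMod p))).mpr h1
          have q2 := (quadraticChar_neg_one_iff_not_isSquare (a := (U : ZMod p))).mpr h3
          rw [← quadraticChar_one_iff_isSquare (mul_ne_zero n1 n2), map_mul, q1, q2]; norm_num
      obtain ⟨r, hr⟩ := hs2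
      obtain ⟨y, hy⟩ := hs_odd p hp h2 (u * U) r.val hw (by
        rw [← ZMod.intCast_zmod_eq_zero_iff_dvd _ p]
        push_cast; rw [hr]; simp; ring) E
      exact ⟨y, (pow_dvd_pow _ (by omega : E ≤ E + 1)).trans hy⟩
  obtain ⟨y, hy⟩ := hsq
  obtain ⟨s, hs⟩ := inv_pp p hp u huz E y
  refine ⟨s, ?_⟩
  have hc : IsCoprime ((p : ℤ) ^ E) (u : ℤ) := ((Prime.coprime_iff_not_dvd hpz).mpr huz).pow_left
  apply hc.dvd_of_dvd_mul_left
  have : (u : ℤ) * (u * (s : ℤ) ^ 2 - U) = (u * s - y) * (u * s + y) + (y ^ 2 - u * U) := by ring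
  rw [this]
  exact dvd_add (Dvd.dvd.mul_right hs _) hy

lemma loc_pp (p : ℕ) (hp : p.Prime) (c : Fin 49 → ℕ) (hc : ∀ i, 0 < c i) (e : ℕ) :
    ∃ (x : Fin 49 → ℤ) (f : ℕ), (p : ℤ) ^ (2 * f + e) ∣ ∑ i, (c i : ℤ) * x i ^ 2 - (p : ℤ) ^ (2 * f) := by
  have hdec : ∀ i, ∃ v u : ℕ, ¬ p ∣ u ∧ c i = p ^ v * u := fun i =>
    Nat.exists_eq_pow_mul_and_not_dvd (hc i).ne' p hp.ne_one
  choose v u hu hcu using hdec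
  let col : Fin 49 → Fin 2 × Fin 8 := fun i => (⟨v i % 2, Nat.mod_lt _ (by norm_num)⟩, sqColor p (u i))
  obtain ⟨y, hy⟩ := Fintype.exists_lt_card_fiber_of_mul_lt_card (f := col) (n := 3) (by simp)
  obtain ⟨S, hS, hcard⟩ := Finset.exists_subset_card_eq (Nat.succ_le_of_lt hy)
  have hScol : ∀ i ∈ S, col i = y := fun i hi => (Finset.mem_filter.mp (hS hi)).2
  obtain ⟨t, ht⟩ : S.Nonempty := by rw [← Finset.card_pos]; omega
  have hpar : ∀ i ∈ S, v i % 2 = v t % 2 := fun i hi => by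
    have h1 := (hScol i hi).trans (hScol t ht).symm
    have := congrArg (fun z => (z.1 : ℕ)) h1
    simpa [col] using this
  have hcol : ∀ i ∈ S, sqColor p (u i) = sqColor p (u t) := fun i hi => by
    have h1 := (hScol i hi).trans (hScol t ht).symm
    exact congrArg Prod.snd h1
  -- a common exponent
  obtain ⟨V, hV1, hV2⟩ : ∃ V, (∀ i, v i ≤ V) ∧ V % 2 = v t % 2 := by
    refine ⟨v t + 2 * ∑ i, v i, fun i => ?_, by omega⟩
    have := Finset.single_le_sum (f := v) (fun j _ => Nat.zero_le _) (Finset.mem_univ i)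
    omega
  have hs' : ∀ i, ∃ s : ℤ, i ∈ S → (p : ℤ) ^ (e + 1) ∣ u i * s ^ 2 - u t := fun i => by
    by_cases hi : i ∈ S
    · obtain ⟨s, h⟩ := same_color p hp (u i) (u t) (hu i) (hu t) (hcol i hi) (e + 1)
      exact ⟨s, fun _ => h⟩
    · exact ⟨0, fun h => absurd h hi⟩
  choose s hs using hs'
  have hut : ¬ (p : ℤ) ∣ u t := by exact_mod_cast hu t
  set ε := V % 2 with hε
  obtain ⟨n, hn⟩ := inv_pp p hp (u t) hut (e + 1) ((p : ℤ) ^ ε)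
  obtain ⟨y1, y2, y3, y4, hy4⟩ := Nat.sum_four_squares n
  -- enumerate S
  let eqv := S.equivFinOfCardEq hcard
  let Y : Fin 4 → ℕ := ![y1, y2, y3, y4]
  let Z : Fin 49 → ℤ := fun i => if h : i ∈ S then (Y (eqv ⟨i, h⟩) : ℤ) else 0
  have hZ : ∑ i ∈ S, Z i ^ 2 = (n : ℤ) := by
    rw [← Finset.sum_attach]
    have : ∀ i : S, Z i.1 ^ 2 = (Y (eqv i) : ℤ) ^ 2 := fun i => by simp [Z]
    rw [Finset.sum_congr rfl fun i _ => this i]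
    have h1 := Equiv.sum_comp eqv (fun j => (Y j : ℤ) ^ 2)
    rw [Finset.univ_eq_attach] at h1
    rw [h1, Fin.sum_univ_four, ← hy4]
    simp [Y]
  refine ⟨fun i => (p : ℤ) ^ ((V - v i) / 2) * s i * Z i, (V + ε) / 2, ?_⟩
  have e0 : 2 * ((V + ε) / 2) = V + ε := by omega
  rw [e0]
  have hterm : ∀ i ∈ S, (c i : ℤ) * ((p : ℤ) ^ ((V - v i) / 2) * s i * Z i) ^ 2
      = (p : ℤ) ^ V * ((u i * s i ^ 2 - u t) * Z i ^ 2) + (p : ℤ) ^ V * u t * Z i ^ 2 := by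
    intro i hi
    have h1 := hpar i hi
    have h2 := hV1 i
    have h3 : (p : ℤ) ^ V = p ^ (v i) * ((p : ℤ) ^ ((V - v i) / 2)) ^ 2 := by
      rw [← pow_mul, ← pow_add]; congr 1; omega
    rw [h3, hcu i]; push_cast; ring
  have hsum : ∑ i, (c i : ℤ) * ((p : ℤ) ^ ((V - v i) / 2) * s i * Z i) ^ 2
      = (p : ℤ) ^ V * ∑ i ∈ S, ((u i * s i ^ 2 - u t) * Z i ^ 2) + (p : ℤ) ^ V * u t * n := by
    rw [← hZ, ← Finset.sum_subset (Finset.subset_univ S), Finset.sum_congr rfl hterm,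
      Finset.sum_add_distrib, Finset.mul_sum, Finset.mul_sum]
    intro i _ hi
    simp [Z, hi]
  rw [hsum]
  have e1 : (p : ℤ) ^ V * ∑ i ∈ S, ((u i * s i ^ 2 - u t) * Z i ^ 2) + (p : ℤ) ^ V * u t * n
      - (p : ℤ) ^ (V + ε) = (p : ℤ) ^ V * (∑ i ∈ S, ((u i * s i ^ 2 - u t) * Z i ^ 2)
        + (u t * n - (p : ℤ) ^ ε)) := by
    rw [pow_add]; ring
  rw [e1]
  have e2 : (p : ℤ) ^ (V + ε + e) ∣ (p : ℤ) ^ V * (p : ℤ) ^ (e + 1) := by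
    rw [← pow_add]; exact pow_dvd_pow _ (by omega)
  refine e2.trans (mul_dvd_mul_left _ (dvd_add (Finset.dvd_sum fun i hi => ?_) hn))
  exact Dvd.dvd.mul_right (hs i hi) _

lemma crt_int (R S : ℕ) (h : R.Coprime S) (x y : ℤ) :
    ∃ z : ℤ, (R : ℤ) ∣ z - x ∧ (S : ℤ) ∣ z - y := by
  obtain ⟨u, v, huv⟩ := Nat.isCoprime_iff_coprime.mpr h
  refine ⟨x * (v * S) + y * (u * R), ⟨(y - x) * u, ?_⟩, ⟨(x - y) * v, ?_⟩⟩
  · linear_combination x * huv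
  · linear_combination y * huv

lemma loc_all (c : Fin 49 → ℕ) (hc : ∀ i, 0 < c i) (K : ℕ) (hK : 0 < K) :
    ∃ (x : Fin 49 → ℤ) (w : ℕ), 0 < w ∧ (∀ l : ℕ, l.Coprime K → l.Coprime w) ∧
      ((w ^ 2 * K : ℕ) : ℤ) ∣ ∑ i, (c i : ℤ) * x i ^ 2 - (w : ℤ) ^ 2 := by
  induction K using Nat.recOnPosPrimePosCoprime with
  | zero => omega
  | one => exact ⟨fun _ => 0, 1, by norm_num, fun l _ => by simp, by simp⟩
  | prime_pow p n hp hn =>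
    obtain ⟨x, f, hx⟩ := loc_pp p hp c hc n
    refine ⟨x, p ^ f, pow_pos hp.pos _, fun l hl => ?_, ?_⟩
    · exact Nat.Coprime.pow_right _ ((Nat.coprime_pow_right_iff hn _ _).mp hl)
    · push_cast
      rw [← pow_mul, ← pow_add, mul_comm f 2]
      exact hx
  | coprime r s hr hs hcop ih1 ih2 =>
    obtain ⟨x1, w1, hw1, hl1, h1⟩ := ih1 (by omega)
    obtain ⟨x2, w2, hw2, hl2, h2⟩ := ih2 (by omega)
    have c1 : w1.Coprime s := (hl1 s hcop.symm).symm
    have c2 : w2.Coprime r := (hl2 r hcop).symm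
    have c3 : w1.Coprime w2 := hl2 w1 c1
    have hco : (w1 ^ 2 * r).Coprime (w2 ^ 2 * s) := by
      apply Nat.Coprime.mul_left
      · exact Nat.Coprime.mul_right (Nat.Coprime.pow _ _ c3) (Nat.Coprime.pow_left _ c1)
      · exact Nat.Coprime.mul_right (Nat.Coprime.pow_right _ c2.symm) hcop
    choose z hz1 hz2 using fun i => crt_int _ _ hco (w2 * x1 i) (w1 * x2 i)
    refine ⟨z, w1 * w2, Nat.mul_pos hw1 hw2, fun l hl => ?_, ?_⟩
    · rw [Nat.coprime_mul_iff_right] at hl ⊢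
      exact ⟨hl1 l hl.1, hl2 l hl.2⟩
    · have e0 : (((w1 * w2) ^ 2 * (r * s) : ℕ) : ℤ) = ((w1 ^ 2 * r : ℕ) : ℤ) * ((w2 ^ 2 * s : ℕ) : ℤ) := by
        push_cast; ring
      rw [e0]
      apply IsCoprime.mul_dvd (Nat.isCoprime_iff_coprime.mpr hco)
      · have e1 : ∑ i, (c i : ℤ) * z i ^ 2 - ((w1 * w2 : ℕ) : ℤ) ^ 2
            = ∑ i, (c i : ℤ) * ((z i - w2 * x1 i) * (z i + w2 * x1 i))
              + (w2 : ℤ) ^ 2 * (∑ i, (c i : ℤ) * x1 i ^ 2 - (w1 : ℤ) ^ 2) := by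
          rw [mul_sub, Finset.mul_sum, add_sub, ← Finset.sum_add_distrib]
          push_cast
          congr 1
          · exact Finset.sum_congr rfl fun i _ => by ring
          · ring
        rw [e1]
        refine dvd_add (Finset.dvd_sum fun i _ => Dvd.dvd.mul_left (Dvd.dvd.mul_right (hz1 i) _) _)
          (Dvd.dvd.mul_left h1 _)
      · have e1 : ∑ i, (c i : ℤ) * z i ^ 2 - ((w1 * w2 : ℕ) : ℤ) ^ 2
            = ∑ i, (c i : ℤ) * ((z i - w1 * x2 i) * (z i + w1 * x2 i))
              + (w1 : ℤ) ^ 2 * (∑ i, (c i : ℤ) * x2 i ^ 2 - (w2 : ℤ) ^ 2) := by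
          rw [mul_sub, Finset.mul_sum, add_sub, ← Finset.sum_add_distrib]
          push_cast
          congr 1
          · exact Finset.sum_congr rfl fun i _ => by ring
          · ring
        rw [e1]
        refine dvd_add (Finset.dvd_sum fun i _ => Dvd.dvd.mul_left (Dvd.dvd.mul_right (hz2 i) _) _)
          (Dvd.dvd.mul_left h2 _)

/-- a diagonal form in 49 variables takes a value `α w²` with `α ≡ 1 mod K`. -/
lemma block_value (c : Fin 49 → ℕ) (hc : ∀ i, 0 < c i) (K : ℕ) (hK : 2 ≤ K) :
    ∃ (x : Fin 49 → ℤ) (w α : ℕ), 0 < w ∧ 0 < α ∧ (K : ℤ) ∣ (α : ℤ) - 1 ∧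
      ∑ i, (c i : ℤ) * x i ^ 2 = α * (w : ℤ) ^ 2 := by
  obtain ⟨x, w, hw, -, t, ht⟩ := loc_all c hc K (by omega)
  have hsum : ∑ i, (c i : ℤ) * x i ^ 2 = (1 + K * t) * (w : ℤ) ^ 2 := by
    push_cast at ht; linear_combination ht
  have hnn : 0 ≤ ∑ i, (c i : ℤ) * x i ^ 2 := Finset.sum_nonneg fun i _ => by positivity
  have hwp : (0 : ℤ) < (w : ℤ) ^ 2 := by positivity
  have h1 : 0 ≤ 1 + (K : ℤ) * t := by
    by_contra hneg
    push Not at hneg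
    have := mul_neg_of_neg_of_pos hneg hwp
    linarith
  have h2 : 1 + (K : ℤ) * t ≠ 0 := by
    intro h
    have hd : (K : ℤ) ∣ 1 := ⟨-t, by linarith⟩
    have := Int.le_of_dvd one_pos hd
    omega
  refine ⟨x, w, (1 + (K : ℤ) * t).toNat, hw, by omega, ?_, ?_⟩
  · rw [Int.toNat_of_nonneg h1]; exact ⟨t, by ring⟩
  · rw [Int.toNat_of_nonneg h1, hsum]

lemma neg_sq_root (α β q : ℕ) (hα : α % 4 = 1) (hβ : β % 4 = 1) (hq4 : q % 4 = 1)
    (hq : q.Prime) (h1 : q % α = 1 % α) (h2 : q % β = α % β) (h3 : β % α = 1 % α) :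
    ∃ w : ℤ, (q : ℤ) ∣ w ^ 2 + α * β := by
  have := Fact.mk hq
  have oα : Odd α := Nat.odd_iff.2 (by omega)
  have oβ : Odd β := Nat.odd_iff.2 (by omega)
  have oq : Odd q := Nat.odd_iff.2 (by omega)
  have a1 : jacobiSym (α : ℤ) q = 1 := by
    rw [jacobiSym.quadratic_reciprocity_one_mod_four hα oq, jacobiSym.mod_left,
      ← Int.natCast_mod, h1, Int.natCast_mod, ← jacobiSym.mod_left]
    simp
  have a2 : jacobiSym (β : ℤ) q = 1 := by
    rw [jacobiSym.quadratic_reciprocity_one_mod_four hβ oq, jacobiSym.mod_left,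
      ← Int.natCast_mod, h2, Int.natCast_mod, ← jacobiSym.mod_left,
      jacobiSym.quadratic_reciprocity_one_mod_four hα oβ, jacobiSym.mod_left,
      ← Int.natCast_mod, h3, Int.natCast_mod, ← jacobiSym.mod_left]
    simp
  have a3 : jacobiSym (-1) q = 1 := by
    rw [jacobiSym.at_neg_one oq, ZMod.χ₄_nat_one_mod_four hq4]
  have a4 : jacobiSym (-1 * (α * β)) q = 1 := by
    rw [jacobiSym.mul_left, jacobiSym.mul_left, a1, a2, a3]; norm_num
  rw [← jacobiSym.legendreSym.to_jacobiSym] at a4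
  have hne : ((-1 * (α * β) : ℤ) : ZMod q) ≠ 0 := by
    intro h0
    rw [(legendreSym.eq_zero_iff q _).2 h0] at a4
    norm_num at a4
  obtain ⟨w, hw⟩ := (legendreSym.eq_one_iff q hne).1 a4
  obtain ⟨w', rfl⟩ := ZMod.intCast_surjective w
  refine ⟨w', ?_⟩
  rw [← ZMod.intCast_zmod_eq_zero_iff_dvd] 
  push_cast at hw ⊢
  linear_combination -hw

lemma sq_abs_diff (x y s B : ℕ) (hx : x ≤ s) (hy : y ≤ s) (hs : s * s ≤ B) :
    ((x : ℤ) - y) ^ 2 ≤ B := by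
  have : ((s : ℤ)) * s ≤ B := by exact_mod_cast hs
  have hx' : (x : ℤ) ≤ s := by exact_mod_cast hx
  have hy' : (y : ℤ) ≤ s := by exact_mod_cast hy
  have h0 : (0 : ℤ) ≤ x := by positivity
  have h1 : (0 : ℤ) ≤ y := by positivity
  nlinarith

set_option maxHeartbeats 1600000 in
lemma legendre_step (α β q : ℕ) (hα : α % 4 = 1) (hβ : β % 4 = 1) (hq4 : q % 4 = 1)
    (hq : q.Prime) (h1 : q % α = 1 % α) (h2 : q % β = α % β) (h3 : β % α = 1 % α) :
    ∃ x y z : ℤ, 0 < z ∧ α * x ^ 2 + β * y ^ 2 = q * z ^ 2 := by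
  suffices H : ∃ x y z : ℤ, z ≠ 0 ∧ α * x ^ 2 + β * y ^ 2 = q * z ^ 2 by
    obtain ⟨x, y, z, hz, h⟩ := H
    exact ⟨x, y, |z|, abs_pos.2 hz, by rw [sq_abs]; exact h⟩
  by_cases hone : α * β = 1
  · have hα1 : α = 1 := Nat.eq_one_of_mul_eq_one_right hone
    have hβ1 : β = 1 := Nat.eq_one_of_mul_eq_one_left hone
    have := Fact.mk hq
    obtain ⟨x, y, hxy⟩ := Nat.Prime.sq_add_sq (p := q) (by omega)
    refine ⟨x, y, 1, one_ne_zero, ?_⟩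
    subst hα1; subst hβ1
    push_cast
    have : (x : ℤ) ^ 2 + y ^ 2 = q := by exact_mod_cast hxy
    linarith
  obtain ⟨w, hw⟩ := neg_sq_root α β q hα hβ hq4 hq h1 h2 h3
  have pα : 0 < α := by omega
  have pβ : 0 < β := by omega
  have pq : 0 < q := hq.pos
  have cαβ : Nat.Coprime α β := by
    have : Nat.gcd β α = Nat.gcd 1 α := Nat.ModEq.gcd_eq h3
    rw [Nat.Coprime, Nat.gcd_comm, this]; simp
  have cqα : Nat.Coprime q α := by
    have : Nat.gcd q α = Nat.gcd 1 α := Nat.ModEq.gcd_eq h1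
    rw [Nat.Coprime, this]; simp
  have cqβ : Nat.Coprime q β := by
    have : Nat.gcd q β = Nat.gcd α β := Nat.ModEq.gcd_eq h2
    rw [Nat.Coprime, this]; exact cαβ
  have d1 : (α : ℤ) ∣ (q : ℤ) - 1 := by
    have := (Nat.modEq_iff_dvd.1 (show 1 ≡ q [MOD α] from h1.symm)); simpa using this
  have d2 : (β : ℤ) ∣ (q : ℤ) - α :=
    (Nat.modEq_iff_dvd.1 (show α ≡ q [MOD β] from h2.symm))
  have d3 : (α : ℤ) ∣ (β : ℤ) - 1 := by
    have := (Nat.modEq_iff_dvd.1 (show 1 ≡ β [MOD α] from h3.symm)); simpa using this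
  set s1 := Nat.sqrt (β * q) with hs1
  set s2 := Nat.sqrt (α * q) with hs2
  set s3 := Nat.sqrt (α * β) with hs3
  have : NeZero α := ⟨by omega⟩
  have : NeZero β := ⟨by omega⟩
  have : NeZero q := ⟨by omega⟩
  let f : Fin (s1 + 1) × Fin (s2 + 1) × Fin (s3 + 1) → ZMod α × ZMod β × ZMod q :=
    fun p => ((((p.2.2 : ℕ) : ℤ) - ((p.2.1 : ℕ) : ℤ) : ℤ),
      ((((p.1 : ℕ) : ℤ) - ((p.2.2 : ℕ) : ℤ) : ℤ) : ZMod β),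
      ((α * ((p.1 : ℕ) : ℤ) - w * ((p.2.1 : ℕ) : ℤ) : ℤ) : ZMod q))
  have hcard : Fintype.card (ZMod α × ZMod β × ZMod q) <
      Fintype.card (Fin (s1 + 1) × Fin (s2 + 1) × Fin (s3 + 1)) := by
    simp only [Fintype.card_prod, ZMod.card, Fintype.card_fin]
    have e1 := Nat.lt_succ_sqrt (β * q)
    have e2 := Nat.lt_succ_sqrt (α * q)
    have e3 := Nat.lt_succ_sqrt (α * β)
    rw [← hs1] at e1; rw [← hs2] at e2; rw [← hs3] at e3
    simp only [Nat.succ_eq_add_one] at e1 e2 e3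
    have e4 : (β * q) * ((α * q) * (α * β)) <
      ((s1 + 1) * (s1 + 1)) * (((s2 + 1) * (s2 + 1)) * ((s3 + 1) * (s3 + 1))) :=
      Nat.mul_lt_mul'' e1 (Nat.mul_lt_mul'' e2 e3)
    apply lt_of_pow_lt_pow_left₀ 2 (by positivity)
    calc _ = (β * q) * ((α * q) * (α * β)) := by ring
      _ < _ := e4
      _ = _ := by ring
  obtain ⟨p, p', hne, hpp⟩ := Fintype.exists_ne_map_eq_of_card_lt f hcard
  obtain ⟨⟨x, hx⟩, ⟨y, hy⟩, ⟨z, hz⟩⟩ := p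
  obtain ⟨⟨x', hx'⟩, ⟨y', hy'⟩, ⟨z', hz'⟩⟩ := p'
  simp only [f, Prod.mk.injEq] at hpp
  obtain ⟨g1, g2, g3⟩ := hpp
  rw [ZMod.intCast_eq_intCast_iff_dvd_sub] at g1 g2 g3
  have bx := sq_abs_diff x' x s1 (β * q) (by omega) (by omega) (Nat.sqrt_le _)
  have hby := sq_abs_diff y' y s2 (α * q) (by omega) (by omega) (Nat.sqrt_le _)
  have bz := sq_abs_diff z' z s3 (α * β) (by omega) (by omega) (Nat.sqrt_le _)
  obtain ⟨X, hX⟩ : ∃ X : ℤ, X = (x' : ℤ) - x := ⟨_, rfl⟩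
  obtain ⟨Y, hY⟩ : ∃ X : ℤ, X = (y' : ℤ) - y := ⟨_, rfl⟩
  obtain ⟨Z, hZ⟩ : ∃ X : ℤ, X = (z' : ℤ) - z := ⟨_, rfl⟩
  rw [← hX] at bx
  rw [← hY] at hby
  rw [← hZ] at bz
  have g1' : (α : ℤ) ∣ Z - Y := by convert g1 using 1; rw [hZ, hY]; ring
  have g2' : (β : ℤ) ∣ X - Z := by convert g2 using 1; rw [hZ, hX]; ring
  have g3' : (q : ℤ) ∣ α * X - w * Y := by convert g3 using 1; rw [hX, hY]; ring
  have hXYZ : ¬ (X = 0 ∧ Y = 0 ∧ Z = 0) := by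
    rintro ⟨r1, r2, r3⟩
    apply hne
    have : x = x' := by omega
    have : y = y' := by omega
    have : z = z' := by omega
    simp [*]
  clear g1 g2 g3 hX hY hZ hne hcard
  push_cast at bx hby bz
  have Pα : (0 : ℤ) < α := by exact_mod_cast pα
  have Pβ : (0 : ℤ) < β := by exact_mod_cast pβ
  have Pq : (0 : ℤ) < q := by exact_mod_cast pq
  have Cαβ : IsCoprime (α : ℤ) β := Nat.isCoprime_iff_coprime.2 cαβ
  have Cqα : IsCoprime (q : ℤ) α := Nat.isCoprime_iff_coprime.2 cqα
  have Cqβ : IsCoprime (q : ℤ) β := Nat.isCoprime_iff_coprime.2 cqβ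
  have f1 : (α : ℤ) ∣ α * X ^ 2 + β * Y ^ 2 - q * Z ^ 2 := by
    obtain ⟨t1, e1⟩ := g1'
    obtain ⟨t2, e2⟩ := d1
    obtain ⟨t3, e3⟩ := d3
    refine ⟨X ^ 2 + t3 * Y ^ 2 - t2 * Z ^ 2 - t1 * (Y + Z), ?_⟩
    linear_combination Y ^ 2 * e3 - Z ^ 2 * e2 - (Y + Z) * e1
  have f2 : (β : ℤ) ∣ α * X ^ 2 + β * Y ^ 2 - q * Z ^ 2 := by
    obtain ⟨t1, e1⟩ := g2'
    obtain ⟨t2, e2⟩ := d2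
    refine ⟨Y ^ 2 - t2 * Z ^ 2 + α * t1 * (X + Z), ?_⟩
    linear_combination - Z ^ 2 * e2 + α * (X + Z) * e1
  have f3 : (q : ℤ) ∣ α * X ^ 2 + β * Y ^ 2 - q * Z ^ 2 := by
    apply Cqα.dvd_of_dvd_mul_left
    obtain ⟨t1, e1⟩ := g3'
    obtain ⟨t2, e2⟩ := hw
    refine ⟨t1 * (α * X + w * Y) + t2 * Y ^ 2 - α * Z ^ 2, ?_⟩
    linear_combination (α * X + w * Y) * e1 + Y ^ 2 * e2
  have f4 : (q : ℤ) * (α * β) ∣ α * X ^ 2 + β * Y ^ 2 - q * Z ^ 2 :=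
    (Cqα.mul_right Cqβ).mul_dvd f3 (Cαβ.mul_dvd f1 f2)
  obtain ⟨t, ht⟩ := f4
  have PP0 : (0 : ℤ) < q * (α * β) := by positivity
  have u1 : (α : ℤ) * X ^ 2 ≤ q * (α * β) := by
    have := mul_le_mul_of_nonneg_left bx Pα.le; linarith
  have u2 : (β : ℤ) * Y ^ 2 ≤ q * (α * β) := by
    have := mul_le_mul_of_nonneg_left hby Pβ.le; linarith
  have u3 : (q : ℤ) * Z ^ 2 ≤ q * (α * β) := by
    have := mul_le_mul_of_nonneg_left bz Pq.le; linarith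
  have v1 : 0 ≤ (α : ℤ) * X ^ 2 := by positivity
  have v2 : 0 ≤ (β : ℤ) * Y ^ 2 := by positivity
  have v3 : 0 ≤ (q : ℤ) * Z ^ 2 := by positivity
  have t1 : t ≤ 2 := by
    by_contra hcon
    have : 3 ≤ t := by omega
    nlinarith
  have t2 : -1 ≤ t := by
    by_contra hcon
    have : t ≤ -2 := by omega
    nlinarith
  have t3 : t ≠ 2 := by
    rintro rfl
    have : (α : ℤ) * X ^ 2 = q * (α * β) := by nlinarith
    have e : X ^ 2 = q * β := by
      apply mul_left_cancel₀ Pα.ne'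
      linear_combination this
    have qX : (q : ℤ) ∣ X :=
      (Nat.prime_iff_prime_int.1 hq).dvd_of_dvd_pow (n := 2) ⟨_, e⟩
    obtain ⟨r, rfl⟩ := qX
    have : (q : ℤ) ∣ β := ⟨r ^ 2, by
      apply mul_left_cancel₀ Pq.ne'
      linear_combination -e⟩
    have : q ∣ β := by exact_mod_cast this
    have : q ∣ 1 := by rw [← cqβ]; exact Nat.dvd_gcd dvd_rfl this
    exact hq.one_lt.ne' (Nat.dvd_one.1 this)
  have t4 : t ≠ -1 := by
    rintro rfl
    have e1 : (α : ℤ) * X ^ 2 = 0 := by linarith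
    have e2 : (β : ℤ) * Y ^ 2 = 0 := by linarith
    have e3 : (q : ℤ) * Z ^ 2 = q * (α * β) := by linarith
    have x0 : X = 0 := by
      rcases mul_eq_zero.1 e1 with h | h
      · omega
      · exact pow_eq_zero_iff (two_ne_zero) |>.1 h
    have y0 : Y = 0 := by
      rcases mul_eq_zero.1 e2 with h | h
      · omega
      · exact pow_eq_zero_iff (two_ne_zero) |>.1 h
    have e4 : Z ^ 2 = α * β := mul_left_cancel₀ Pq.ne' e3
    subst x0; subst y0
    have : (α * β : ℤ) ∣ Z := by
      apply Cαβ.mul_dvd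
      · simpa using g1'
      · simpa using g2'
    obtain ⟨r, rfl⟩ := this
    have : (α * β : ℤ) * ((α * β) * r ^ 2) = (α * β : ℤ) * 1 := by linear_combination e4
    have := mul_left_cancel₀ (by positivity) this
    have h9 : (α * β : ℤ) = 1 := Int.eq_one_of_mul_eq_one_right (by positivity) this
    exact hone (by exact_mod_cast h9)
  have : t = 0 ∨ t = 1 := by omega
  rcases this with rfl | rfl
  · refine ⟨X, Y, Z, ?_, by linarith⟩
    rintro rfl
    have e1 : (α : ℤ) * X ^ 2 = 0 := by linarith
    have e2 : (β : ℤ) * Y ^ 2 = 0 := by linarith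
    apply hXYZ
    refine ⟨?_, ?_, rfl⟩
    · rcases mul_eq_zero.1 e1 with h | h
      · omega
      · exact pow_eq_zero_iff (two_ne_zero) |>.1 h
    · rcases mul_eq_zero.1 e2 with h | h
      · omega
      · exact pow_eq_zero_iff (two_ne_zero) |>.1 h
  · refine ⟨X * Z + β * Y, Y * Z - α * X, Z ^ 2 + α * β, by positivity, ?_⟩
    linear_combination (Z ^ 2 + α * β) * ht

lemma prime_step (M r : ℕ) (hM : 4 ∣ M) (hM0 : 0 < M) (hr : r.Coprime M) (hr4 : r % 4 = 1)
    (c : Fin 2 → Fin 49 → ℕ) (hc : ∀ i l, 0 < c i l) :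
    ∃ M' r' : ℕ, M ∣ M' ∧ 0 < M' ∧ r'.Coprime M' ∧ r' ≡ r [MOD M] ∧
      ∀ q : ℕ, q.Prime → q ≡ r' [MOD M'] →
        ∃ X : Fin 2 → Fin 49 → ℤ, ∃ Z : ℤ, 0 < Z ∧
          ∑ i, ∑ l, (c i l : ℤ) * X i l ^ 2 = q * Z ^ 2 := by
  have hM2 : 2 ≤ M := by have := Nat.le_of_dvd hM0 hM; omega
  obtain ⟨x, w1, α, hw1, hα0, hα, hx⟩ := block_value (c 0) (hc 0) M hM2
  obtain ⟨y, w2, β, hw2, hβ0, hβ, hy⟩ := block_value (c 1) (hc 1) (M * α) (by nlinarith)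
  have mα : α ≡ 1 [MOD M] := ((Nat.modEq_iff_dvd (n := M) (a := 1) (b := α)).2 (by simpa using hα)).symm
  have mβ : β ≡ 1 [MOD M * α] :=
    ((Nat.modEq_iff_dvd (n := M * α) (a := 1) (b := β)).2 (by simpa using hβ)).symm
  have mβM : β ≡ 1 [MOD M] := Nat.ModEq.of_mul_right _ mβ
  have mβα : β ≡ 1 [MOD α] := Nat.ModEq.of_mul_left _ mβ
  have cαM : Nat.Coprime α M := by
    have := mα.gcd_eq; rw [Nat.Coprime, this]; simp
  have cβ : Nat.Coprime β (M * α) := by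
    have := mβ.gcd_eq; rw [Nat.Coprime, this]; simp
  obtain ⟨r1, hr1, hr1'⟩ := Nat.chineseRemainder cαM.symm r 1
  obtain ⟨r2, hr2, hr2'⟩ := Nat.chineseRemainder cβ.symm r1 α
  have k1 : r2 ≡ r [MOD M] := (Nat.ModEq.of_mul_right _ hr2).trans hr1
  have k2 : r2 ≡ 1 [MOD α] := (Nat.ModEq.of_mul_left _ hr2).trans hr1'
  refine ⟨M * α * β, r2, ⟨α * β, by ring⟩, by positivity, ?_, k1, ?_⟩
  · apply Nat.Coprime.mul_right
    · apply Nat.Coprime.mul_right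
      · rw [Nat.Coprime, k1.gcd_eq]; exact hr
      · rw [Nat.Coprime, k2.gcd_eq]; simp
    · rw [Nat.Coprime, hr2'.gcd_eq]
      exact (Nat.Coprime.coprime_mul_left_right cβ).symm
  · intro q hq hqr
    have q1 : q ≡ r [MOD M] := (Nat.ModEq.of_mul_right _ (Nat.ModEq.of_mul_right _ hqr)).trans k1
    have q2 : q ≡ 1 [MOD α] :=
      (Nat.ModEq.of_mul_left _ (Nat.ModEq.of_mul_right _ hqr)).trans k2
    have q3 : q ≡ α [MOD β] := (Nat.ModEq.of_mul_left _ hqr).trans hr2'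
    have q4 : q % 4 = 1 := by
      have := q1.of_dvd hM
      unfold Nat.ModEq at this; omega
    have α4 : α % 4 = 1 := by
      have := mα.of_dvd hM
      unfold Nat.ModEq at this; omega
    have β4 : β % 4 = 1 := by
      have := mβM.of_dvd hM
      unfold Nat.ModEq at this; omega
    obtain ⟨u, v, z, hz, huv⟩ := legendre_step α β q α4 β4 q4 hq q2 q3 mβα
    refine ⟨![fun l => u * w2 * x l, fun l => v * w1 * y l], z * w1 * w2, by positivity, ?_⟩
    rw [Fin.sum_univ_two]
    have e1 : ∑ l, (c 0 l : ℤ) * (u * w2 * x l) ^ 2 = (u * w2) ^ 2 * (α * (w1 : ℤ) ^ 2) := by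
      rw [← hx, Finset.mul_sum]; exact Finset.sum_congr rfl fun _ _ => by ring
    have e2 : ∑ l, (c 1 l : ℤ) * (v * w1 * y l) ^ 2 = (v * w1) ^ 2 * (β * (w2 : ℤ) ^ 2) := by
      rw [← hy, Finset.mul_sum]; exact Finset.sum_congr rfl fun _ _ => by ring
    simp only [Matrix.cons_val_zero, Matrix.cons_val_one]
    rw [e1, e2]
    linear_combination (w1 : ℤ) ^ 2 * w2 ^ 2 * huv

lemma prime_iter (c : ℕ → Fin 2 → Fin 49 → ℕ) (hc : ∀ j i l, 0 < c j i l) (n : ℕ) :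
    ∃ M r : ℕ, 4 ∣ M ∧ 0 < M ∧ r.Coprime M ∧ r % 4 = 1 ∧
      ∀ q : ℕ, q.Prime → q ≡ r [MOD M] → ∀ j < n,
        ∃ X : Fin 2 → Fin 49 → ℤ, ∃ Z : ℤ, 0 < Z ∧
          ∑ i, ∑ l, (c j i l : ℤ) * X i l ^ 2 = q * Z ^ 2 := by
  induction n with
  | zero => exact ⟨4, 1, dvd_rfl, by norm_num, by norm_num, by norm_num, by simp⟩
  | succ n ih =>
    obtain ⟨M, r, h4, h0, hr, hr4, H⟩ := ih
    obtain ⟨M', r', hd, h0', hr', hrr, H'⟩ := prime_step M r h4 h0 hr hr4 (c n) (hc n)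
    refine ⟨M', r', h4.trans hd, h0', hr', ?_, ?_⟩
    · have := hrr.of_dvd h4
      unfold Nat.ModEq at this; omega
    · intro q hq hqr j hj
      rcases Nat.lt_succ_iff_lt_or_eq.1 hj with hj | rfl
      · exact H q hq ((hqr.of_dvd hd).trans hrr) j hj
      · exact H' q hq hqr

lemma prime_common (c : Fin 4 → Fin 2 → Fin 49 → ℕ) (hc : ∀ j i l, 0 < c j i l) :
    ∃ q : ℕ, 0 < q ∧ ∀ j, ∃ X : Fin 2 → Fin 49 → ℤ, ∃ Z : ℤ, 0 < Z ∧
          ∑ i, ∑ l, (c j i l : ℤ) * X i l ^ 2 = q * Z ^ 2 := by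
  obtain ⟨M, r, h4, h0, hr, hr4, H⟩ := prime_iter
    (fun j => if h : j < 4 then c ⟨j, h⟩ else fun _ _ => 1)
    (by intro j i l; split_ifs; exacts [hc _ _ _, one_pos]) 4
  obtain ⟨q, -, hq, hqr⟩ := Nat.forall_exists_prime_gt_and_modEq 0 h0.ne' hr
  refine ⟨q, hq.pos, fun j => ?_⟩
  have := H q hq hqr j j.2
  simpa using this

/-- Four orthogonal vectors of equal norm. -/
lemma ortho (b : Fin 4 × Fin 2 × Fin 49 × Fin 2 → ℕ) (hb : ∀ i, 0 < b i) :
    ∃ (v : Fin 4 → (Fin 4 × Fin 2 × Fin 49 × Fin 2) → ℤ) (d : ℕ), 0 < d ∧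
      (∀ j, ∑ i, (b i : ℤ) * v j i = 0) ∧
      (∀ j l, ∑ i, (b i : ℤ) * (v j i * v l i) = if j = l then 2 * (d : ℤ) else 0) := by
  obtain ⟨q, hq, H⟩ := prime_common
    (fun j i l => b (j, i, l, 0) * b (j, i, l, 1) * (b (j, i, l, 0) + b (j, i, l, 1)))
    (fun j i l => by
      have := hb (j, i, l, 0); have := hb (j, i, l, 1); positivity)
  choose X Z hZ hX using H
  set P : ℤ := ∏ j, Z j with hP
  have hPpos : 0 < P := Finset.prod_pos fun j _ => hZ j
  have hd : ∀ j, ∃ Y : ℤ, Z j * Y = P := fun j =>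
    (Finset.dvd_prod_of_mem Z (Finset.mem_univ j)).imp fun _ h => h.symm
  choose Y hY using hd
  refine ⟨fun j i => if j = i.1 then
      2 * Y j * X j i.2.1 i.2.2.1 * (if i.2.2.2 = 0 then (b (i.1, i.2.1, i.2.2.1, 1) : ℤ)
        else -(b (i.1, i.2.1, i.2.2.1, 0) : ℤ)) else 0, 2 * q * P.toNat ^ 2, ?_, ?_, ?_⟩
  · have : 0 < P.toNat := by omega
    positivity
  · intro j
    simp only [Fintype.sum_prod_type, Fin.sum_univ_two (M := ℤ)]
    simp
    apply Finset.sum_eq_zero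
    intro j' _
    by_cases h : j = j'
    · subst h
      simp
      rw [← Finset.sum_add_distrib]
      apply Finset.sum_eq_zero
      intro l _
      ring
    · simp [h]
  · intro j l
    split_ifs with hjl
    · subst hjl
      rw [Fintype.sum_prod_type, Finset.sum_eq_single j]
      · have e := hX j
        have e2 : (2 * Y j) ^ 2 * (q * Z j ^ 2) = 2 * (2 * q * P ^ 2) := by
          rw [← hY j]; ring
        push_cast
        rw [Int.toNat_of_nonneg hPpos.le]
        rw [← e2, ← e, Finset.mul_sum, Fintype.sum_prod_type]
        apply Finset.sum_congr rfl
        intro i _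
        rw [Finset.mul_sum, Fintype.sum_prod_type]
        apply Finset.sum_congr rfl
        intro l _
        rw [Fin.sum_univ_two]
        simp
        ring
      · intro j' _ hj'
        simp [hj'.symm]
      · simp
    · apply Finset.sum_eq_zero
      intro i _
      by_cases h : j = i.1
      · have : l ≠ i.1 := fun h' => hjl (h.trans h'.symm)
        simp [this]
      · simp [h]

lemma PP_le (k x : ℕ) (hk : 1 ≤ k) : PP k x ≤ k * x ^ 2 := by
  have h := two_PP k x
  have h2 : (2 : ℤ) * (PP k x : ℤ) ≤ 2 * ((k : ℤ) * x ^ 2) := by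
    rw [h, GG]
    have hk' : (1 : ℤ) ≤ k := by exact_mod_cast hk
    have hx : (0 : ℤ) ≤ x := by positivity
    rcases Nat.eq_zero_or_pos x with rfl | h0
    · simp
    · have hx1 : (1 : ℤ) ≤ x := by exact_mod_cast h0
      nlinarith [mul_nonneg (sub_nonneg.2 hk') (mul_nonneg hx (by linarith : (0 : ℤ) ≤ (x : ℤ) + 1))]
  exact_mod_cast (by linarith : (PP k x : ℤ) ≤ (k : ℤ) * x ^ 2)

lemma PP_step (k u h : ℕ) (hk : 1 ≤ k) : PP k (u + h) ≤ PP k u + k * (u * h + h ^ 2) := by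
  have h1 := two_PP k u
  have h2 := two_PP k (u + h)
  have h3 : (2 : ℤ) * (PP k (u + h) : ℤ) ≤ 2 * ((PP k u : ℤ) + (k : ℤ) * (u * h + h ^ 2)) := by
    rw [mul_add, h1, h2, GG, GG]
    have hk' : (1 : ℤ) ≤ k := by exact_mod_cast hk
    have hh : (0 : ℤ) ≤ h := by positivity
    push_cast
    rcases Nat.eq_zero_or_pos h with rfl | h0
    · simp
    · have hx1 : (1 : ℤ) ≤ h := by exact_mod_cast h0
      nlinarith [mul_nonneg (sub_nonneg.2 hk') (mul_nonneg hh (by linarith : (0 : ℤ) ≤ (h : ℤ) + 1))]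
  exact_mod_cast (by linarith : (PP k (u + h) : ℤ) ≤ (PP k u : ℤ) + (k : ℤ) * (u * h + h ^ 2))

lemma PP_dvd (k d s : ℕ) : ((k * d : ℕ) : ℤ) ∣ (PP k (2 * (k * d) * s) : ℤ) := by
  have h := two_PP k (2 * (k * d) * s)
  rw [GG] at h
  refine ⟨s * (k * (2 * (k * d) * s - 1) + 2), ?_⟩
  push_cast at h ⊢
  linarith

lemma sum_bPP {ι : Type*} [Fintype ι] (b : ι → ℕ) (v : Fin 4 → ι → ℤ) (d : ℕ)
    (h0 : ∀ j, ∑ i, (b i : ℤ) * v j i = 0)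
    (h1 : ∀ j l, ∑ i, (b i : ℤ) * (v j i * v l i) = if j = l then 2 * (d : ℤ) else 0)
    (k u : ℕ) (t : Fin 4 → ℤ) (y : ι → ℕ) (hy : ∀ i, (y i : ℤ) = u + ∑ j, t j * v j i) :
    ∑ i, (b i : ℤ) * PP k (y i) = (∑ i, (b i : ℤ)) * PP k u + k * d * ∑ j, t j ^ 2 := by
  have s1 : ∑ i, (b i : ℤ) * ∑ j, t j * v j i = 0 := by
    simp_rw [Finset.mul_sum]
    rw [Finset.sum_comm]
    apply Finset.sum_eq_zero
    intro j _
    have : ∑ i, (b i : ℤ) * (t j * v j i) = t j * ∑ i, (b i : ℤ) * v j i := by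
      rw [Finset.mul_sum]; exact Finset.sum_congr rfl fun _ _ => by ring
    rw [this, h0, mul_zero]
  have s2 : ∑ i, (b i : ℤ) * (∑ j, t j * v j i) ^ 2 = 2 * d * ∑ j, t j ^ 2 := by
    have e : ∀ i, (b i : ℤ) * (∑ j, t j * v j i) ^ 2 =
        ∑ j, ∑ l, (t j * t l) * ((b i : ℤ) * (v j i * v l i)) := by
      intro i
      rw [pow_two, Finset.sum_mul_sum, Finset.mul_sum]
      refine Finset.sum_congr rfl fun j _ => ?_
      rw [Finset.mul_sum]
      exact Finset.sum_congr rfl fun l _ => by ring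
    simp_rw [e]
    rw [Finset.sum_comm, Finset.mul_sum]
    refine Finset.sum_congr rfl fun j _ => ?_
    rw [Finset.sum_comm]
    simp_rw [← Finset.mul_sum, h1]
    simp
    ring
  have e : ∀ i, 2 * ((b i : ℤ) * PP k (y i)) = (b i : ℤ) * (2 * PP k u) +
      (k * (2 * u - 1) + 2) * ((b i : ℤ) * ∑ j, t j * v j i) +
      k * ((b i : ℤ) * (∑ j, t j * v j i) ^ 2) := by
    intro i
    have a1 := two_PP k (y i)
    have a2 := two_PP k u
    rw [mul_left_comm, a1, a2, GG, GG, hy i]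
    ring
  have : 2 * ∑ i, (b i : ℤ) * PP k (y i) =
      2 * ((∑ i, (b i : ℤ)) * PP k u + k * d * ∑ j, t j ^ 2) := by
    rw [Finset.mul_sum]
    simp_rw [e]
    rw [Finset.sum_add_distrib, Finset.sum_add_distrib, ← Finset.mul_sum, ← Finset.mul_sum,
      ← Finset.sum_mul, s1, s2]
    ring
  linarith

set_option maxHeartbeats 1000000 in
lemma final_asm_aux {ι : Type*} [Fintype ι] [Nonempty ι] (b : ι → ℕ) (hb : ∀ i, 0 < b i) (A : ℕ)
    (v : Fin 4 → ι → ℤ) (d : ℕ) (hd : 0 < d) (hv0 : ∀ j, ∑ i, (b i : ℤ) * v j i = 0)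
    (hv1 : ∀ j l, ∑ i, (b i : ℤ) * (v j i * v l i) = if j = l then 2 * (d : ℤ) else 0) :
    ∃ C : ℕ, ∀ k : ℕ, 1 ≤ k → ∀ (κ : Type) [Fintype κ] (a : κ → ℕ), ∑ i, a i ≤ A →
      (∀ R : ℕ, 0 < R → ∀ N : ℤ, ∃ x : κ → ℕ, (R : ℤ) ∣ ∑ i, (a i : ℤ) * GG k (x i) - 2 * N) →
      ∀ N : ℕ, C * k ^ 3 ≤ N → ∃ (x : κ → ℕ) (y : ι → ℕ),
        ∑ i, a i * PP k (x i) + ∑ i, b i * PP k (y i) = N := by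
  inhabit ι
  obtain ⟨V, hV⟩ : ∃ V : ℕ, ∀ j i, |v j i| ≤ V := by
    refine ⟨∑ j, ∑ i, (v j i).natAbs, fun j i => ?_⟩
    rw [Int.abs_eq_natAbs]
    have h1 : (v j i).natAbs ≤ ∑ i, (v j i).natAbs :=
      Finset.single_le_sum (f := fun i => (v j i).natAbs) (fun _ _ => Nat.zero_le _) (Finset.mem_univ i)
    have h2 : ∑ i, (v j i).natAbs ≤ ∑ j, ∑ i, (v j i).natAbs :=
      Finset.single_le_sum (f := fun j => ∑ i, (v j i).natAbs) (fun _ _ => Nat.zero_le _) (Finset.mem_univ j)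
    exact_mod_cast h1.trans h2
  set S := ∑ i, b i with hS
  have hS0 : 0 < S := by
    have : b default ≤ S :=
      Finset.single_le_sum (f := b) (fun _ _ => Nat.zero_le _) (Finset.mem_univ _)
    have := hb default
    omega
  clear_value S
  set L := 16 * V ^ 2 * S + 2 * d with hL
  refine ⟨4 * A * d ^ 2 + S * (L + 2 * d) ^ 2, ?_⟩
  intro k hk κ _ a hA hcov N hN
  set R := k * d with hR
  have hR0 : 0 < R := by positivity
  obtain ⟨x0, hx0⟩ := hcov (2 * R) (by positivity) N
  set x : κ → ℕ := fun i => x0 i % (2 * R) with hx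
  have hxlt : ∀ i, x i ≤ 2 * R := fun i => (Nat.mod_lt _ (by positivity)).le
  have hE : (R : ℤ) ∣ ∑ i, (a i : ℤ) * PP k (x i) - N := by
    have h1 : ((2 * R : ℕ) : ℤ) ∣ ∑ i, (a i : ℤ) * GG k (x i) - ∑ i, (a i : ℤ) * GG k (x0 i) := by
      rw [← Finset.sum_sub_distrib]
      apply Finset.dvd_sum
      intro i _
      rw [← mul_sub]
      apply Dvd.dvd.mul_left
      apply GG_congr
      have := Int.emod_emod_of_dvd (x0 i : ℤ) (dvd_refl ((2 * R : ℕ) : ℤ))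
      have := Int.ModEq.dvd (this.symm : (x0 i : ℤ) ≡ _ [ZMOD ((2 * R : ℕ) : ℤ)])
      simpa [hx] using this
    have h2 := dvd_add h1 hx0
    have h3 : ∑ i, (a i : ℤ) * GG k (x i) = 2 * ∑ i, (a i : ℤ) * PP k (x i) := by
      rw [Finset.mul_sum]
      refine Finset.sum_congr rfl fun i _ => ?_
      rw [← two_PP]; ring
    obtain ⟨t, ht⟩ := h2
    refine ⟨t, ?_⟩
    push_cast at ht
    linarith
  set E := ∑ i, a i * PP k (x i) with hEdef
  have hEle : E ≤ 4 * A * d ^ 2 * k ^ 3 := by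
    calc E ≤ ∑ i, a i * (k * (2 * R) ^ 2) := by
          apply Finset.sum_le_sum
          intro i _
          apply Nat.mul_le_mul_left
          refine (PP_le k (x i) hk).trans ?_
          have := hxlt i
          gcongr
      _ = (∑ i, a i) * (k * (2 * R) ^ 2) := by rw [Finset.sum_mul]
      _ ≤ A * (k * (2 * R) ^ 2) := by gcongr
      _ = _ := by rw [hR]; ring
  have hEc : (E : ℤ) = ∑ i, (a i : ℤ) * PP k (x i) := by rw [hEdef]; push_cast; rfl
  rw [← hEc] at hE
  clear_value E
  obtain ⟨N', hN'⟩ : ∃ N', N = E + N' := ⟨N - E, by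
    rw [add_mul] at hN; omega⟩
  have hN'big : S * (L + 2 * d) ^ 2 * k ^ 3 ≤ N' := by
    rw [add_mul] at hN; omega
  have hRN' : (R : ℤ) ∣ N' := by
    rw [hN'] at hE
    push_cast at hE
    have : (N' : ℤ) = -((E : ℤ) - (E + N')) := by ring
    rw [this]; exact (dvd_neg).2 hE
  -- choose s
  obtain ⟨s, hs1, hs2⟩ : ∃ s, S * PP k (2 * R * s) ≤ N' ∧ N' < S * PP k (2 * R * s + 2 * R) := by
    have hex : ∃ s, N' < S * PP k (2 * R * (s + 1)) := by
      refine ⟨N', ?_⟩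
      have h1 : 2 * R * (N' + 1) ≤ PP k (2 * R * (N' + 1)) := by
        unfold PP; exact Nat.le_add_left _ _
      nlinarith
    classical
    refine ⟨Nat.find hex, ?_, ?_⟩
    · by_cases h : Nat.find hex = 0
      · rw [h]; simp [PP_zero]
      · have := Nat.find_min hex (m := Nat.find hex - 1) (by omega)
        rw [Nat.sub_add_cancel (by omega)] at this
        omega
    · have := Nat.find_spec hex
      rwa [mul_add, mul_one] at this
  set u := 2 * R * s with hu
  have hRu : (R : ℤ) ∣ (PP k u : ℤ) := PP_dvd k d s
  clear_value u
  obtain ⟨D, hD⟩ : ∃ D : ℕ, N' = S * PP k u + R * D := by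
    have h1 : R ∣ N' := by exact_mod_cast hRN'
    have h2 : R ∣ PP k u := by exact_mod_cast hRu
    obtain ⟨D, hD⟩ := Nat.dvd_sub h1 (h2.mul_left S)
    exact ⟨D, by omega⟩
  have hDle : D ≤ 2 * S * k * (u + 2 * R) := by
    have h1 := PP_step k u (2 * R) hk
    have h2 : S * PP k u + R * D < S * (PP k u + k * (u * (2 * R) + (2 * R) ^ 2)) := by
      rw [← hD]; exact hs2.trans_le (Nat.mul_le_mul_left _ h1)
    have h3 : R * D ≤ R * (2 * S * k * (u + 2 * R)) := by
      have : S * (PP k u + k * (u * (2 * R) + (2 * R) ^ 2)) =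
        S * PP k u + R * (2 * S * k * (u + 2 * R)) := by ring
      omega
    exact Nat.le_of_mul_le_mul_left h3 hR0
  have huL : L * k ≤ u := by
    by_contra hcon
    push Not at hcon
    have h1 : PP k (u + 2 * R) ≤ k * (L * k + 2 * R) ^ 2 := by
      refine (PP_le _ _ hk).trans ?_
      gcongr
    have h2 : S * PP k (u + 2 * R) ≤ S * (k * (L * k + 2 * R) ^ 2) := Nat.mul_le_mul_left _ h1
    have h3 : S * (k * (L * k + 2 * R) ^ 2) = S * (L + 2 * d) ^ 2 * k ^ 3 := by rw [hR]; ring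
    omega
  obtain ⟨t0, t1, t2, t3, ht⟩ := Nat.sum_four_squares D
  have hsum : V * (t0 + t1 + t2 + t3) ≤ u := by
    apply le_of_pow_le_pow_left₀ (n := 2) two_ne_zero (Nat.zero_le _)
    have c1 : (t0 + t1 + t2 + t3) ^ 2 ≤ 4 * D := by
      rw [← ht]
      zify
      nlinarith [sq_nonneg ((t0 : ℤ) - t1), sq_nonneg ((t0 : ℤ) - t2), sq_nonneg ((t0 : ℤ) - t3),
        sq_nonneg ((t1 : ℤ) - t2), sq_nonneg ((t1 : ℤ) - t3), sq_nonneg ((t2 : ℤ) - t3)]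
    have c2 : 2 * R ≤ u := by
      refine le_trans ?_ huL
      rw [hL, hR]
      nlinarith [Nat.zero_le (16 * V ^ 2 * S * k)]
    have c3 : 16 * V ^ 2 * S * k ≤ u := by
      refine le_trans ?_ huL
      rw [hL]
      nlinarith [Nat.zero_le (2 * d * k)]
    calc (V * (t0 + t1 + t2 + t3)) ^ 2 = V ^ 2 * (t0 + t1 + t2 + t3) ^ 2 := by ring
      _ ≤ V ^ 2 * (4 * (2 * S * k * (u + u))) := by
          apply Nat.mul_le_mul_left
          refine c1.trans (Nat.mul_le_mul_left _ (hDle.trans ?_))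
          apply Nat.mul_le_mul_left; omega
      _ = (16 * V ^ 2 * S * k) * u := by ring
      _ ≤ u * u := Nat.mul_le_mul_right _ c3
      _ = u ^ 2 := by ring
  let t : Fin 4 → ℤ := ![t0, t1, t2, t3]
  have hnn : ∀ i, 0 ≤ (u : ℤ) + ∑ j, t j * v j i := by
    intro i
    have h1 : |∑ j, t j * v j i| ≤ ∑ j, t j * V := by
      refine (Finset.abs_sum_le_sum_abs _ _).trans (Finset.sum_le_sum fun j _ => ?_)
      have tj : 0 ≤ t j := by fin_cases j <;> simp [t]
      rw [abs_mul, abs_of_nonneg tj]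
      exact mul_le_mul_of_nonneg_left (hV j i) tj
    have h2 : ∑ j, t j * (V : ℤ) ≤ u := by
      rw [← Finset.sum_mul, Fin.sum_univ_four]
      simp only [t, Matrix.cons_val]
      have : ((V * (t0 + t1 + t2 + t3) : ℕ) : ℤ) ≤ u := by exact_mod_cast hsum
      push_cast at this
      linarith
    have := abs_le.1 (h1.trans h2)
    linarith [this.1]
  refine ⟨x, fun i => ((u : ℤ) + ∑ j, t j * v j i).toNat, ?_⟩
  have key := sum_bPP b v d hv0 hv1 k u t (fun i => ((u : ℤ) + ∑ j, t j * v j i).toNat)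
    (fun i => Int.toNat_of_nonneg (hnn i))
  have ht' : ∑ j, t j ^ 2 = (D : ℤ) := by
    rw [Fin.sum_univ_four, ← ht]
    simp only [t, Matrix.cons_val]
    push_cast; ring
  have hS' : ∑ i, (b i : ℤ) = S := by rw [hS]; push_cast; rfl
  rw [ht', hS'] at key
  rw [← hEdef, hN', hD]
  zify
  rw [key, hR]
  push_cast
  ring

lemma final_asm (b : Fin 4 × Fin 2 × Fin 49 × Fin 2 → ℕ) (hb : ∀ i, 0 < b i) (A : ℕ) :
    ∃ C : ℕ, ∀ k : ℕ, 1 ≤ k → ∀ (κ : Type) [Fintype κ] (a : κ → ℕ), ∑ i, a i ≤ A →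
      (∀ R : ℕ, 0 < R → ∀ N : ℤ, ∃ x : κ → ℕ, (R : ℤ) ∣ ∑ i, (a i : ℤ) * GG k (x i) - 2 * N) →
      ∀ N : ℕ, C * k ^ 3 ≤ N → ∃ (x : κ → ℕ) (y : Fin 4 × Fin 2 × Fin 49 × Fin 2 → ℕ),
        ∑ i, a i * PP k (x i) + ∑ i, b i * PP k (y i) = N := by
  obtain ⟨v, d, hd, hv0, hv1⟩ := ortho b hb
  exact final_asm_aux b hb A v d hd hv0 hv1

/-- the form with coefficients `a` represents `N` -/
def GRep (k : ℕ) {κ : Type} [Fintype κ] (a : κ → ℕ) (N : ℕ) : Prop :=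
  ∃ x : κ → ℕ, ∑ i, a i * PP k (x i) = N

lemma Rep_equiv (k : ℕ) {κ κ' : Type} [Fintype κ] [Fintype κ'] (e : κ' ≃ κ) (a : κ → ℕ) (N : ℕ) :
    GRep k (fun j => a (e j)) N ↔ GRep k a N := by
  constructor
  · rintro ⟨x, hx⟩
    refine ⟨fun i => x (e.symm i), ?_⟩
    rw [← hx, ← Equiv.sum_comp e]
    simp
  · rintro ⟨x, hx⟩
    refine ⟨fun i => x (e i), ?_⟩
    rw [← hx, ← Equiv.sum_comp e]

lemma le_PP (k x : ℕ) : x ≤ PP k x := by unfold PP; exact Nat.le_add_left _ _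

lemma PP_one (k : ℕ) : PP k 1 = 1 := by simp [PP]

lemma PP_big (k x : ℕ) (hx : 2 ≤ x) : k + 2 ≤ PP k x := by
  unfold PP
  have : 0 < x.choose 2 := Nat.choose_pos hx
  have : k * 1 ≤ k * x.choose 2 := Nat.mul_le_mul_left _ this
  omega

lemma trunc_large (k s H : ℕ) (hk : s * H < k) {κ : Type} [Fintype κ] (a : κ → ℕ)
    (hs : Fintype.card κ ≤ s) (ha : ∀ i, a i ≤ H) : ¬ GRep k a (s * H + 1) := by
  rintro ⟨x, hx⟩
  have h1 : ∀ i, a i * PP k (x i) ≤ H := by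
    intro i
    have hle : a i * PP k (x i) ≤ s * H + 1 := by
      rw [← hx]
      exact Finset.single_le_sum (f := fun i => a i * PP k (x i)) (fun _ _ => Nat.zero_le _)
        (Finset.mem_univ i)
    rcases Nat.eq_zero_or_pos (a i) with h | h
    · rw [h]; simp
    · have hx2 : x i < 2 := by
        by_contra hcon
        have := PP_big k (x i) (by omega)
        nlinarith
      have := ha i
      interval_cases hxi : x i
      · simp [PP_zero]
      · simpa [PP_one] using this
  have h2 : ∑ i, a i * PP k (x i) ≤ Fintype.card κ * H := by
    have := Finset.sum_le_card_nsmul Finset.univ (fun i => a i * PP k (x i)) H (fun i _ => h1 i)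
    simpa using this
  have h3 : Fintype.card κ * H ≤ s * H := Nat.mul_le_mul_right _ hs
  omega

lemma finite_sup {ι : Type*} [Fintype ι] [DecidableEq ι] (T : ℕ) (C : (ι → ℕ) → ℕ) :
    ∃ M, ∀ b : ι → ℕ, (∀ i, b i ≤ T) → C b ≤ M := by
  refine ⟨∑ b ∈ Fintype.piFinset (fun _ : ι => Finset.range (T + 1)), C b, fun b hb => ?_⟩
  refine Finset.single_le_sum (f := C) (fun _ _ => Nat.zero_le _) ?_
  simp only [Fintype.mem_piFinset, Finset.mem_range]
  intro i
  have := hb i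
  omega

lemma finite_sup_nat (T : ℕ) (C : ℕ → ℕ) : ∃ M, ∀ b ≤ T, C b ≤ M := by
  refine ⟨∑ b ∈ Finset.range (T + 1), C b, fun b hb => ?_⟩
  exact Finset.single_le_sum (f := C) (fun _ _ => Nat.zero_le _) (Finset.mem_range.2 (by omega))

lemma trunc (s H : ℕ) : ∃ T : ℕ, ∀ k : ℕ, ∀ (κ : Type) [Fintype κ] (a : κ → ℕ),
    Fintype.card κ ≤ s → (∀ i, a i ≤ H) →
    (∀ N, 0 < N → GRep k a N) ∨ ∃ N, 0 < N ∧ N ≤ T ∧ ¬ GRep k a N := by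
  have h1 : ∀ (k s' : ℕ) (c : Fin s' → ℕ), ∃ m : ℕ,
      (∀ N, 0 < N → GRep k c N) ∨ ∃ N, 0 < N ∧ N ≤ m ∧ ¬ GRep k c N := by
    intro k s' c
    by_cases h : ∀ N, 0 < N → GRep k c N
    · exact ⟨0, Or.inl h⟩
    · push Not at h
      obtain ⟨N, hN, hr⟩ := h
      exact ⟨N, Or.inr ⟨N, hN, le_rfl, hr⟩⟩
  choose m hm using h1
  have h2 : ∀ k s', ∃ M, ∀ c : Fin s' → ℕ, (∀ i, c i ≤ H) → m k s' c ≤ M :=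
    fun k s' => finite_sup H (m k s')
  choose M2 hM2 using h2
  have h3 : ∀ k, ∃ M, ∀ s' ≤ s, M2 k s' ≤ M := fun k => finite_sup_nat s (M2 k)
  choose M3 hM3 using h3
  obtain ⟨M4, hM4⟩ := finite_sup_nat (s * H) M3
  refine ⟨s * H + 1 + M4, ?_⟩
  intro k κ _ a hs ha
  by_cases hk : s * H < k
  · exact Or.inr ⟨s * H + 1, by omega, by omega, trunc_large k s H hk a hs ha⟩
  · let e : Fin (Fintype.card κ) ≃ κ := (Fintype.equivFin κ).symm
    have hb : m k _ (fun j => a (e j)) ≤ M4 :=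
      (hM2 k _ _ (fun i => ha (e i))).trans ((hM3 k _ hs).trans (hM4 k (by omega)))
    rcases hm k _ (fun j => a (e j)) with h | ⟨N, hN, hle, hr⟩
    · exact Or.inl fun N hN => (Rep_equiv k e a N).1 (h N hN)
    · exact Or.inr ⟨N, hN, by omega, fun h => hr ((Rep_equiv k e a N).2 h)⟩

/-- extension by zero -/
def extz {n : ℕ} (I : Finset (Fin n)) (x : I → ℕ) (i : Fin n) : ℕ :=
  if h : i ∈ I then x ⟨i, h⟩ else 0

lemma sum_extz (k : ℕ) {n : ℕ} (a : Fin n → ℕ) (I : Finset (Fin n)) (x : I → ℕ) :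
    ∑ i, a i * PP k (extz I x i) = ∑ i : I, a i * PP k (x i) := by
  have h1 : ∑ i, a i * PP k (extz I x i) = ∑ i ∈ I, a i * PP k (extz I x i) := by
    symm
    apply Finset.sum_subset (Finset.subset_univ I)
    intro i _ hi
    simp [extz, hi, PP_zero]
  rw [h1, ← Finset.sum_coe_sort]
  refine Finset.sum_congr rfl fun i _ => ?_
  simp [extz]

lemma Rep_of_sub (k : ℕ) {n : ℕ} (a : Fin n → ℕ) (I : Finset (Fin n)) (N : ℕ)
    (h : GRep k (fun i : I => a i) N) : GRep k a N := by
  obtain ⟨x, hx⟩ := h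
  exact ⟨extz I x, by rw [sum_extz, hx]⟩

lemma Rep_sub_of (k : ℕ) {n : ℕ} (a : Fin n → ℕ) (I : Finset (Fin n)) (x : Fin n → ℕ)
    (hx : ∀ i, i ∉ I → x i = 0) : GRep k (fun i : I => a i) (∑ i, a i * PP k (x i)) := by
  refine ⟨fun i => x i, ?_⟩
  rw [← sum_extz k a I (fun i => x i)]
  refine Finset.sum_congr rfl fun i _ => ?_
  by_cases h : i ∈ I
  · simp [extz, h]
  · simp [extz, h, hx i h]

lemma Rep_two (k : ℕ) {n : ℕ} (a : Fin n → ℕ) (I J : Finset (Fin n)) (hd : Disjoint I J)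
    (x : I → ℕ) (y : J → ℕ) :
    GRep k a (∑ i : I, a i * PP k (x i) + ∑ i : J, a i * PP k (y i)) := by
  refine ⟨fun i => extz I x i + extz J y i, ?_⟩
  rw [← sum_extz, ← sum_extz, ← Finset.sum_add_distrib]
  refine Finset.sum_congr rfl fun i _ => ?_
  by_cases h : i ∈ I
  · have : i ∉ J := Finset.disjoint_left.1 hd h
    simp [extz, this, PP_zero]
  · simp [extz, h, PP_zero]

lemma coef_le (k : ℕ) {n : ℕ} (a : Fin n → ℕ) (x : Fin n → ℕ) (i : Fin n) (h : x i ≠ 0) :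
    a i ≤ ∑ i, a i * PP k (x i) := by
  have h1 : a i * PP k (x i) ≤ ∑ i, a i * PP k (x i) :=
    Finset.single_le_sum (f := fun i => a i * PP k (x i)) (fun _ _ => Nat.zero_le _)
      (Finset.mem_univ i)
  have h2 := le_PP k (x i)
  have h3 : a i * 1 ≤ a i * PP k (x i) := Nat.mul_le_mul_left _ (by omega)
  omega

lemma esc (s H r : ℕ) : ∃ T : ℕ, ∀ (k n : ℕ) (a : Fin n → ℕ) (I : Finset (Fin n)),
    I.card ≤ s → (∀ i ∈ I, a i ≤ H) → (∀ N, 1 ≤ N → N ≤ T → GRep k a N) →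
    (∀ N, 0 < N → GRep k a N) ∨
      ∃ J : Finset (Fin n), Disjoint I J ∧ J.card = r ∧ ∀ i ∈ J, a i ≤ T := by
  induction r with
  | zero => exact ⟨0, fun k n a I _ _ _ => Or.inr ⟨∅, by simp⟩⟩
  | succ r ih =>
    obtain ⟨T, hT⟩ := ih
    obtain ⟨T', hT'⟩ := trunc (s + r) (H + T)
    refine ⟨T + T', ?_⟩
    intro k n a I hI ha hrep
    rcases hT k n a I hI ha (fun N h1 h2 => hrep N h1 (by omega)) with h | ⟨J, hJ, hc, hJT⟩
    · exact Or.inl h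
    · have hcard : Fintype.card ↥(I ∪ J) ≤ s + r := by
        rw [Fintype.card_coe]
        have := Finset.card_union_le I J
        omega
      have hle : ∀ i : ↥(I ∪ J), a i ≤ H + T := by
        rintro ⟨i, hi⟩
        rcases Finset.mem_union.1 hi with h | h
        · have := ha i h; simp only; omega
        · have := hJT i h; simp only; omega
      rcases hT' k ↥(I ∪ J) (fun i => a i) hcard hle with h | ⟨N, hN, hNT, hr⟩
      · exact Or.inl fun N hN => Rep_of_sub k a _ N (h N hN)
      · right
        obtain ⟨x, hx⟩ := hrep N hN (by omega)
        obtain ⟨j, hj, hxj⟩ : ∃ j, j ∉ I ∪ J ∧ x j ≠ 0 := by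
          by_contra hcon
          push Not at hcon
          apply hr
          rw [← hx]
          exact Rep_sub_of k a _ x hcon
        have haj := coef_le k a x j hxj
        rw [hx] at haj
        rw [Finset.mem_union, not_or] at hj
        refine ⟨insert j J, ?_, ?_, ?_⟩
        · rw [Finset.disjoint_insert_right]; exact ⟨hj.1, hJ⟩
        · rw [Finset.card_insert_of_notMem hj.2, hc]
        · intro i hi
          rcases Finset.mem_insert.1 hi with rfl | hi
          · omega
          · have := hJT i hi; omega

lemma supp_card (k : ℕ) {n : ℕ} (a : Fin n → ℕ) (ha : ∀ i, 0 < a i) (x : Fin n → ℕ) :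
    (Finset.univ.filter fun i => x i ≠ 0).card ≤ ∑ i, a i * PP k (x i) := by
  rw [Finset.card_eq_sum_ones]
  calc _ ≤ ∑ i ∈ Finset.univ.filter (fun i => x i ≠ 0), a i * PP k (x i) := by
        apply Finset.sum_le_sum
        intro i hi
        have h1 : x i ≠ 0 := (Finset.mem_filter.1 hi).2
        have h2 := le_PP k (x i)
        exact Nat.mul_pos (ha i) (by omega)
    _ ≤ _ := Finset.sum_le_sum_of_subset (Finset.filter_subset _ _)

lemma collect (k n : ℕ) (a : Fin n → ℕ) (ha : ∀ i, 0 < a i) (J : Finset (Fin n)) (n0 : ℕ)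
    (hrep : ∀ N, 1 ≤ N → N ≤ n0 → GRep k a N) :
    ∃ I : Finset (Fin n), J ⊆ I ∧ I.card ≤ J.card + n0 * n0 ∧ (∀ i ∈ I, i ∈ J ∨ a i ≤ n0) ∧
      ∀ N, 1 ≤ N → N ≤ n0 → GRep k (fun i : I => a i) N := by
  have : ∀ N, ∃ x : Fin n → ℕ, 1 ≤ N → N ≤ n0 → ∑ i, a i * PP k (x i) = N := by
    intro N
    by_cases h : 1 ≤ N ∧ N ≤ n0
    · obtain ⟨x, hx⟩ := hrep N h.1 h.2
      exact ⟨x, fun _ _ => hx⟩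
    · exact ⟨0, fun h1 h2 => absurd ⟨h1, h2⟩ h⟩
  choose x hx using this
  set U := (Finset.Icc 1 n0).biUnion (fun N => Finset.univ.filter fun i => x N i ≠ 0) with hU
  refine ⟨J ∪ U, Finset.subset_union_left, ?_, ?_, ?_⟩
  · have h1 : U.card ≤ (Finset.Icc 1 n0).card * n0 := by
      apply Finset.card_biUnion_le_card_mul
      intro N hN
      rw [Finset.mem_Icc] at hN
      refine (supp_card k a ha (x N)).trans ?_
      rw [hx N hN.1 hN.2]; exact hN.2
    have h2 : (Finset.Icc 1 n0).card = n0 := by simp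
    rw [h2] at h1
    have := Finset.card_union_le J U
    omega
  · intro i hi
    rcases Finset.mem_union.1 hi with h | h
    · exact Or.inl h
    · right
      simp only [hU, Finset.mem_biUnion, Finset.mem_Icc, Finset.mem_filter, Finset.mem_univ,
        true_and] at h
      obtain ⟨N, hN, hi⟩ := h
      have := coef_le k a (x N) i hi
      rw [hx N hN.1 hN.2] at this
      omega
  · intro N h1 h2
    have := Rep_sub_of k a (J ∪ U) (x N) (by
      intro i hi
      by_contra hcon
      apply hi
      apply Finset.mem_union_right
      rw [hU, Finset.mem_biUnion]
      exact ⟨N, Finset.mem_Icc.2 ⟨h1, h2⟩, by simpa using hcon⟩)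
    rwa [hx N h1 h2] at this

lemma main_nat : ∃ Γ : ℕ, 0 < Γ ∧ ∀ (k : ℕ), 1 ≤ k → ∀ (n : ℕ) (a : Fin n → ℕ), (∀ i, 0 < a i) →
    (∀ N, 1 ≤ N → N ≤ Γ * k ^ 3 → GRep k a N) → ∀ N, 0 < N → GRep k a N := by
  obtain ⟨T0, hT0⟩ := esc 0 0 3
  set H := T0 + 2 with hH
  set n0 := H ^ 4 with hn0
  have hn01 : 1 ≤ n0 := Nat.one_le_pow _ _ (by omega)
  clear_value n0
  obtain ⟨T1, hT1⟩ := esc (3 + n0 * n0) (T0 + n0) (Fintype.card (Fin 4 × Fin 2 × Fin 49 × Fin 2))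
  have hFA : ∀ b : Fin 4 × Fin 2 × Fin 49 × Fin 2 → ℕ, ∃ C : ℕ, (∀ i, 0 < b i) →
      ∀ k : ℕ, 1 ≤ k → ∀ (κ : Type) [Fintype κ] (a : κ → ℕ),
      ∑ i, a i ≤ (3 + n0 * n0) * (T0 + n0) →
      (∀ R : ℕ, 0 < R → ∀ N : ℤ, ∃ x : κ → ℕ, (R : ℤ) ∣ ∑ i, (a i : ℤ) * GG k (x i) - 2 * N) →
      ∀ N : ℕ, C * k ^ 3 ≤ N → ∃ (x : κ → ℕ) (y : Fin 4 × Fin 2 × Fin 49 × Fin 2 → ℕ),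
        ∑ i, a i * PP k (x i) + ∑ i, b i * PP k (y i) = N := by
    intro b
    by_cases hb : ∀ i, 0 < b i
    · obtain ⟨C, hC⟩ := final_asm b hb ((3 + n0 * n0) * (T0 + n0))
      exact ⟨C, fun _ => hC⟩
    · exact ⟨0, fun h => absurd h hb⟩
  choose Cf hCf using hFA
  obtain ⟨C2, hC2⟩ := finite_sup T1 Cf
  refine ⟨T0 + n0 + T1 + C2 + 1, by omega, ?_⟩
  intro k hk n a ha hrep N hN
  have hk3 : 1 ≤ k ^ 3 := Nat.one_le_pow _ _ hk
  have hG : T0 + n0 + T1 + C2 + 1 ≤ (T0 + n0 + T1 + C2 + 1) * k ^ 3 := Nat.le_mul_of_pos_right _ hk3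
  have hCk : C2 * k ^ 3 ≤ (T0 + n0 + T1 + C2 + 1) * k ^ 3 := Nat.mul_le_mul_right _ (by omega)
  by_cases hNs : N ≤ (T0 + n0 + T1 + C2 + 1) * k ^ 3
  · exact hrep N hN hNs
  rcases hT0 k n a ∅ (by simp) (by simp) (fun N h1 h2 => hrep N h1 (by omega)) with
    h | ⟨J3, -, hJ3c, hJ3⟩
  · exact h N hN
  obtain ⟨I, hJI, hIc, hIa, hIrep⟩ := collect k n a ha J3 n0 (fun N h1 h2 => hrep N h1 (by omega))
  have hIa' : ∀ i ∈ I, a i ≤ T0 + n0 := by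
    intro i hi
    rcases hIa i hi with h | h
    · have := hJ3 i h; omega
    · omega
  rw [hJ3c] at hIc
  rcases hT1 k n a I hIc hIa' (fun N h1 h2 => hrep N h1 (by omega)) with h | ⟨J, hIJ, hJc, hJa⟩
  · exact h N hN
  let e : (Fin 4 × Fin 2 × Fin 49 × Fin 2) ≃ J := Fintype.equivOfCardEq (by rw [Fintype.card_coe, hJc])
  have hsum : ∑ i : I, a i ≤ (3 + n0 * n0) * (T0 + n0) := by
    have h1 := Finset.sum_le_card_nsmul (Finset.univ : Finset I) (fun i => a i) (T0 + n0)
      (fun i _ => hIa' i i.2)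
    have h2 : (Finset.univ : Finset I).card = I.card := by simp
    rw [h2, smul_eq_mul] at h1
    exact h1.trans (Nat.mul_le_mul_right _ hIc)
  obtain ⟨j1, j2, j3, h12, h13, h23, hJ⟩ := Finset.card_eq_three.1 hJ3c
  have m1 : j1 ∈ J3 := by rw [hJ]; simp
  have m2 : j2 ∈ J3 := by rw [hJ]; simp
  have m3 : j3 ∈ J3 := by rw [hJ]; simp
  obtain ⟨i0, hi0⟩ : ∃ i0 : I, a i0 = 1 := by
    obtain ⟨x, hx⟩ := hIrep 1 le_rfl hn01
    obtain ⟨i, -, hi⟩ := Finset.exists_ne_zero_of_sum_ne_zero (by rw [hx]; exact one_ne_zero)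
    refine ⟨i, ?_⟩
    have h1 : a i * PP k (x i) ≤ 1 := by
      rw [← hx]
      exact Finset.single_le_sum (f := fun i : I => a i * PP k (x i)) (fun _ _ => Nat.zero_le _)
        (Finset.mem_univ i)
    have h2 : a i * PP k (x i) ≠ 0 := hi
    exact Nat.eq_one_of_mul_eq_one_right (by omega : a i * PP k (x i) = 1)
  have hcov := cov_all k (fun i : I => a i) H (by omega) i0 hi0 ⟨j1, hJI m1⟩ ⟨j2, hJI m2⟩
    ⟨j3, hJI m3⟩ (by simpa using h12) (by simpa using h13) (by simpa using h23)
    ⟨ha _, by have := hJ3 j1 m1; simp only; omega⟩ ⟨ha _, by have := hJ3 j2 m2; simp only; omega⟩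
    ⟨ha _, by have := hJ3 j3 m3; simp only; omega⟩
    (fun N h1 h2 => hIrep N h1 (by rw [hn0]; exact h2))
  have hCb := hC2 (fun i => a (e i)) (fun i => hJa _ (e i).2)
  have hCbk : Cf (fun i => a (e i)) * k ^ 3 ≤ C2 * k ^ 3 := Nat.mul_le_mul_right _ hCb
  obtain ⟨x, y, hxy⟩ := hCf (fun i => a (e i)) (fun i => ha _) k hk I (fun i => a i) hsum hcov N
    (by omega)
  rw [← hxy]
  have := Rep_two k a I J hIJ x (fun j => y (e.symm j))
  rw [← Equiv.sum_comp e (fun i : J => a i * PP k (y (e.symm i)))] at this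
  simpa using this

lemma polyNum_PP (m : ℤ) (hm : 3 ≤ m) (x : ℕ) : polyNum m x = (PP (m - 2).toNat x : ℤ) := by
  have h := two_PP (m - 2).toNat x
  rw [GG, Int.toNat_of_nonneg (by omega)] at h
  unfold polyNum
  omega

/-- there is an absolute constant `C > 0` such that for every `m ≥ 3`
there is `γ ≤ C·(m-2)³` with: any `m`-gonal form representing `1, …, γ` over `ℕ₀`
is universal over `ℕ₀`. -/
theorem stmt1 :
    ∃ C : ℝ, 0 < C ∧
      ∀ m : ℤ, 3 ≤ m →
        ∃ γ : ℕ, 0 < γ ∧ (γ : ℝ) ≤ C * ((m : ℝ) - 2) ^ 3 ∧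
          ∀ (n : ℕ) (a : Fin n → ℤ), (∀ i, 0 < a i) →
            (∀ N : ℤ, 1 ≤ N → N ≤ (γ : ℤ) →
              ∃ x : Fin n → ℕ, ∑ i, a i * polyNum m ((x i : ℤ)) = N) →
            ∀ N : ℤ, 0 < N → ∃ x : Fin n → ℕ, ∑ i, a i * polyNum m ((x i : ℤ)) = N := by
  obtain ⟨Γ, hΓ, H⟩ := main_nat
  refine ⟨Γ, by exact_mod_cast hΓ, fun m hm => ?_⟩
  have hk : 1 ≤ (m - 2).toNat := by omega
  have hkc : (((m - 2).toNat : ℕ) : ℝ) = (m : ℝ) - 2 := by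
    have : (((m - 2).toNat : ℕ) : ℤ) = m - 2 := Int.toNat_of_nonneg (by omega)
    have : ((((m - 2).toNat : ℕ) : ℤ) : ℝ) = ((m - 2 : ℤ) : ℝ) := by rw [this]
    push_cast at this
    exact this
  refine ⟨Γ * (m - 2).toNat ^ 3, by positivity, ?_, ?_⟩
  · rw [← hkc]; push_cast; exact le_rfl
  · intro n a ha hrep N hN
    have key : ∀ (x : Fin n → ℕ), ∑ i, a i * polyNum m ((x i : ℤ)) =
        ((∑ i, (a i).toNat * PP (m - 2).toNat (x i) : ℕ) : ℤ) := by
      intro x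
      push_cast
      refine Finset.sum_congr rfl fun i _ => ?_
      rw [polyNum_PP m hm]
      have := ha i
      congr 1
      omega
    obtain ⟨x, hx⟩ := H _ hk n (fun i => (a i).toNat) (fun i => by have := ha i; omega)
      (fun M h1 h2 => by
        obtain ⟨x, hx⟩ := hrep M (by exact_mod_cast h1) (by exact_mod_cast h2)
        rw [key] at hx
        exact ⟨x, by exact_mod_cast hx⟩) N.toNat (by omega)
    refine ⟨x, ?_⟩
    rw [key, hx]
    omega
end

section
/- Let n ≥ 5 and let a₁,…,aₙ be positive integers. There exists a positive integer K, depending only on a₁,…,aₙ, with the following property: for every integer m ≥ 3 and all integers A ≥ 0 and B with 0 ≤ B ≤ m−3, if the integer A(m−2)+B is locally represented by ⟨a₁,…,aₙ⟩_m, then there is a residue class k₀ modulo K such that for every integer k' ≡ k₀ (mod K) and every prime p, the equation (B+k'(m−2) − (a₂y₂+⋯+aₙyₙ))² + a₁a₂y₂² + ⋯ + a₁aₙyₙ² = (2A+B+k'(m−4))·a₁ has a solution (y₂,…,yₙ) ∈ ℤ_p^{n−1}. -/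
lemma aux_pig : ∀ f : Fin 5 → Bool,
    ∃ σ : Equiv.Perm (Fin 5), f (σ 0) = f (σ 1) ∧ f (σ 1) = f (σ 2) := by
  decide +kernel

/-- Boolean search for a solution modulo `8`. -/
def auxChk (u v w d e : ℕ) : Bool :=
  [(1,0,0),(0,1,0),(0,0,1),(1,1,0),(1,0,1),(0,1,1),(1,1,1),(1,2,0),(1,0,2),(0,1,2),(2,1,0),(2,0,1),
    (0,2,1),(1,1,2),(1,2,1),(2,1,1),(1,2,2),(2,1,2),(2,2,1)].any fun t : ℕ × ℕ × ℕ =>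
    [(0,0),(0,1),(1,0),(1,1)].any fun q : ℕ × ℕ =>
      Nat.beq ((u * (t.1 * t.1) + v * (t.2.1 * t.2.1) + w * (t.2.2 * t.2.2)
        + d * q.1 + e * q.2) % 8) 0

lemma aux_chk : ([1,3,5,7].all fun u => [1,3,5,7].all fun v => [1,3,5,7].all fun w =>
    [1,2,3,5,6,7].all fun d => [1,2,3,5,6,7].all fun e => auxChk u v w d e) = true := by
  decide +kernel

lemma aux_dy (u v w d e : ZMod 8) (hu : 4 * u ≠ 0) (hv : 4 * v ≠ 0) (hw : 4 * w ≠ 0)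
    (hd : 2 * d ≠ 0) (he : 2 * e ≠ 0) :
  ∃ x y z : ℕ, (x = 1 ∨ y = 1 ∨ z = 1) ∧ ∃ r s : ℕ,
    u * (x : ZMod 8) ^ 2 + v * (y : ZMod 8) ^ 2 + w * (z : ZMod 8) ^ 2
      + d * (r : ZMod 8) ^ 2 + e * (s : ZMod 8) ^ 2 = 0 := by
  have h4 : ∀ u : ZMod 8, 4 * u ≠ 0 → u.val ∈ [1,3,5,7] := by decide
  have h2 : ∀ u : ZMod 8, 2 * u ≠ 0 → u.val ∈ [1,2,3,5,6,7] := by decide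
  have h := aux_chk
  simp only [List.all_eq_true] at h
  have h' := h _ (h4 u hu) _ (h4 v hv) _ (h4 w hw) _ (h2 d hd) _ (h2 e he)
  unfold auxChk at h'
  rw [List.any_eq_true] at h'
  obtain ⟨⟨x, y, z⟩, hx, h'⟩ := h'
  rw [List.any_eq_true] at h'
  obtain ⟨⟨r, s⟩, hr, h'⟩ := h'
  refine ⟨x, y, z, ?_, r, s, ?_⟩
  · simp at hx; omega
  · have h3 := Nat.eq_of_beq_eq_true h'
    have h5 := (ZMod.natCast_eq_zero_iff _ 8).2 (Nat.dvd_of_mod_eq_zero h3)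
    have hr1 : (r : ZMod 8) ^ 2 = r ∧ (s : ZMod 8) ^ 2 = s := by
      simp at hr
      rcases hr with ⟨rfl, rfl⟩ | ⟨rfl, rfl⟩ | ⟨rfl, rfl⟩ | ⟨rfl, rfl⟩ <;> simp
    rw [hr1.1, hr1.2]
    simp only [Nat.cast_add, Nat.cast_mul, ZMod.natCast_val, ZMod.cast_id', id] at h5
    linear_combination h5
section
variable {p : ℕ} [hp : Fact p.Prime]

lemma aux_sq_lift (u : ℤ_[p]) (h : ‖u - 1‖ < ‖(2 : ℤ_[p])‖ ^ 2) : ∃ z, z ^ 2 = u := by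
  obtain ⟨z, hz, -⟩ := hensels_lemma (p := p) (R := ℤ_[p])
    (F := Polynomial.X ^ 2 - Polynomial.C u) (a := 1) (by
      simp
      rw [norm_sub_rev]
      exact_mod_cast h)
  refine ⟨z, ?_⟩
  simpa [sub_eq_zero] using hz

lemma aux_lift {ι : Type*} [Fintype ι] [DecidableEq ι] (c x : ι → ℤ_[p]) (i : ι)
    (hc : ‖c i‖ = 1) (hx : ‖x i‖ = 1) (N : ℤ_[p])
    (h : ‖∑ j, c j * x j ^ 2 - N‖ < ‖(2 : ℤ_[p])‖ ^ 2) :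
    ∃ y : ι → ℤ_[p], y ≠ 0 ∧ ∑ j, c j * y j ^ 2 = N := by
  obtain ⟨gi, hgi⟩ := ((PadicInt.isUnit_iff (z := c i * x i ^ 2)).2
    (by simp [hc, hx])).exists_right_inv
  obtain ⟨E, hE⟩ : ∃ E, E = ∑ j, c j * x j ^ 2 - N := ⟨_, rfl⟩
  rw [← hE] at h
  have h2 : ‖(2 : ℤ_[p])‖ ^ 2 ≤ 1 := pow_le_one₀ (norm_nonneg _) (PadicInt.norm_le_one _)
  have hgn : ‖gi‖ = 1 := by
    have := congrArg norm hgi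
    simpa [hc, hx] using this
  obtain ⟨z, hz⟩ := aux_sq_lift (1 - E * gi) (by
    have : (1 - E * gi) - 1 = - (E * gi) := by ring
    rw [this, norm_neg, norm_mul, hgn, mul_one]; exact h)
  refine ⟨Function.update x i (z * x i), ?_, ?_⟩
  · intro h0
    have h1 := congrFun h0 i
    simp only [Function.update_self, Pi.zero_apply, mul_eq_zero] at h1
    rcases h1 with h1 | h1
    · rw [h1] at hz
      have h3 : E * gi = 1 := by linear_combination hz
      have h4 : ‖E‖ = 1 := by
        have := congrArg norm h3
        rwa [norm_mul, hgn, mul_one, norm_one] at this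
      linarith
    · simp [h1] at hx
  · have e1 : ∑ j, c j * x j ^ 2 = c i * x i ^ 2 + ∑ j ∈ Finset.univ.erase i, c j * x j ^ 2 :=
      (Finset.add_sum_erase _ _ (Finset.mem_univ i)).symm
    rw [← Finset.add_sum_erase _ _ (Finset.mem_univ i)]
    rw [Finset.sum_congr rfl (g := fun j => c j * x j ^ 2) (fun j hj => by
      rw [Function.update_of_ne (Finset.ne_of_mem_erase hj)])]
    rw [e1] at hE
    simp only [Function.update_self]
    linear_combination c i * x i ^ 2 * hz - E * hgi - hE

lemma aux_quad (hp2 : p ≠ 2) (u v r : ℤ_[p]) (hu : ‖u‖ = 1) (hv : ‖v‖ = 1) :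
    ∃ a b : ℤ_[p], ‖u * a ^ 2 + v * b ^ 2 - r‖ < 1 := by
  have key : ∀ z : ℤ_[p], PadicInt.toZMod z = 0 ↔ ‖z‖ < 1 := by
    intro z
    rw [← RingHom.mem_ker, PadicInt.ker_toZMod, IsLocalRing.mem_maximalIdeal,
      PadicInt.mem_nonunits]
  have hu' : PadicInt.toZMod u ≠ 0 := by rw [Ne, key]; linarith
  have hv' : PadicInt.toZMod v ≠ 0 := by rw [Ne, key]; linarith
  obtain ⟨a, b, hab⟩ := FiniteField.exists_root_sum_quadratic (R := ZMod p)
    (f := Polynomial.C (PadicInt.toZMod u) * Polynomial.X ^ 2 + Polynomial.C 0 * Polynomial.X + Polynomial.C 0)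
    (g := Polynomial.C (PadicInt.toZMod v) * Polynomial.X ^ 2 + Polynomial.C 0 * Polynomial.X
      + Polynomial.C (- PadicInt.toZMod r)) (Polynomial.degree_quadratic hu')
      (Polynomial.degree_quadratic hv') (by
        rw [ZMod.card]; exact hp.out.eq_two_or_odd.resolve_left hp2)
  obtain ⟨a, rfl⟩ := ZMod.ringHom_surjective (PadicInt.toZMod (p := p)) a
  obtain ⟨b, rfl⟩ := ZMod.ringHom_surjective (PadicInt.toZMod (p := p)) b
  refine ⟨a, b, ?_⟩
  rw [← key]
  simp at hab
  simp
  linear_combination hab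

lemma aux_two_norm (hp2 : p ≠ 2) : ‖(2 : ℤ_[p])‖ = 1 := by
  by_contra h
  have h1 : ‖((2 : ℤ) : ℤ_[p])‖ < 1 := lt_of_le_of_ne (PadicInt.norm_le_one _) (by exact_mod_cast h)
  rw [PadicInt.norm_int_lt_one_iff_dvd] at h1
  have : p ∣ 2 := by exact_mod_cast h1
  exact hp2 ((Nat.prime_dvd_prime_iff_eq hp.out Nat.prime_two).1 this)

lemma aux_good (hp2 : p ≠ 2) (c1 c2 c3 N : ℤ_[p]) (h1 : ‖c1‖ = 1) (h2 : ‖c2‖ = 1)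
    (h3 : ‖c3‖ = 1) : ∃ x y z : ℤ_[p], c1 * x ^ 2 + c2 * y ^ 2 + c3 * z ^ 2 = N := by
  obtain ⟨a, b, hab⟩ := aux_quad hp2 c1 c2 (N - c3) h1 h2
  obtain ⟨y, -, hy⟩ := aux_lift ![c1, c2, c3] ![a, b, 1] 2 (by simpa using h3) (by simp) N (by
    rw [aux_two_norm hp2]
    simp only [Fin.sum_univ_three]
    simp
    convert hab using 2
    ring)
  refine ⟨y 0, y 1, y 2, ?_⟩
  simpa [Fin.sum_univ_three] using hy
end
section
variable {p : ℕ} [hp : Fact p.Prime]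

lemma aux_iso3_two (d : Fin 5 → ℤ_[2]) (h0 : ‖d 0‖ = 1) (h1 : ‖d 1‖ = 1)
    (h2 : ‖d 2‖ = 1) (h : ∀ i, 1 / 2 ≤ ‖d i‖) :
    ∃ y : Fin 5 → ℤ_[2], y ≠ 0 ∧ ∑ j, d j * y j ^ 2 = 0 := by
  let f : ℤ_[2] →+* ZMod 8 := PadicInt.toZModPow 3
  have key : ∀ z, f z = 0 ↔ ‖z‖ ≤ 1 / 8 := by
    intro z
    rw [← RingHom.mem_ker]
    have := PadicInt.norm_le_pow_iff_mem_span_pow z 3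
    rw [← PadicInt.ker_toZModPow] at this
    refine this.symm.trans ?_
    norm_num
  have n2 : ‖(2 : ℤ_[2])‖ = 1 / 2 := by
    have := PadicInt.norm_p (p := 2)
    norm_num at this ⊢
    exact this
  have hu : ∀ u : ℤ_[2], ‖u‖ = 1 → 4 * f u ≠ 0 := by
    intro u hu h
    have h' : f (2 * 2 * u) = 0 := by rw [map_mul, map_mul, ← h, map_ofNat]; norm_num
    rw [key, norm_mul, norm_mul, n2, hu] at h'
    norm_num at h'
  have hd : ∀ u : ℤ_[2], 1 / 2 ≤ ‖u‖ → 2 * f u ≠ 0 := by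
    intro u hu h
    have h' : f (2 * u) = 0 := by rw [map_mul, ← h, map_ofNat]
    rw [key, norm_mul, n2] at h'
    linarith
  obtain ⟨x, y, z, hxyz, r, s, hs⟩ := aux_dy (f (d 0)) (f (d 1)) (f (d 2)) (f (d 3)) (f (d 4))
    (hu _ h0) (hu _ h1) (hu _ h2) (hd _ (h 3)) (hd _ (h 4))
  have hE : ‖∑ j, d j * (![(x : ℤ_[2]), (y : ℤ_[2]), (z : ℤ_[2]), (r : ℤ_[2]),
      (s : ℤ_[2])] : Fin 5 → ℤ_[2]) j ^ 2 - 0‖ < ‖(2 : ℤ_[2])‖ ^ 2 := by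
    refine lt_of_le_of_lt ((key _).1 ?_) (by rw [n2]; norm_num : (1 / 8 : ℝ) < _)
    rw [sub_zero, Fin.sum_univ_five]
    simp only [map_add, map_mul, map_pow, Matrix.cons_val, map_natCast]
    exact hs
  rcases hxyz with rfl | rfl | rfl
  · exact aux_lift d _ 0 h0 (by simp) 0 hE
  · exact aux_lift d _ 1 h1 (by simp) 0 hE
  · exact aux_lift d _ 2 h2 (by simp) 0 hE

lemma aux_iso3 (d : Fin 5 → ℤ_[p]) (h0 : ‖d 0‖ = 1) (h1 : ‖d 1‖ = 1)
    (h2 : ‖d 2‖ = 1) (h : ∀ i, 1 / (p : ℝ) ≤ ‖d i‖) :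
    ∃ y : Fin 5 → ℤ_[p], y ≠ 0 ∧ ∑ j, d j * y j ^ 2 = 0 := by
  by_cases hp2 : p = 2
  · subst hp2
    exact aux_iso3_two d h0 h1 h2 (by simpa using h)
  · obtain ⟨a, b, hab⟩ := aux_quad hp2 (d 0) (d 1) (- d 2) h0 h1
    refine aux_lift d ![a, b, 1, 0, 0] 2 h2 (by simp) 0 ?_
    rw [aux_two_norm hp2, Fin.sum_univ_five]
    simp
    convert hab using 2
    ring

lemma aux_red (c : ℚ_[p]) (hc : c ≠ 0) : ∃ (s s' : ℚ_[p]) (d d' : ℤ_[p]), s ≠ 0 ∧ s' ≠ 0 ∧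
    c = s ^ 2 * d ∧ p * c = s' ^ 2 * d' ∧ 1 / (p : ℝ) ≤ ‖d‖ ∧ 1 / (p : ℝ) ≤ ‖d'‖ ∧
    (‖d‖ = 1 ∨ ‖d'‖ = 1) := by
  have hp0 : (p : ℚ_[p]) ≠ 0 := by exact_mod_cast hp.out.ne_zero
  have hp1 : 1 / (p : ℝ) ≤ 1 := by
    rw [div_le_one (by exact_mod_cast hp.out.pos)]; exact_mod_cast hp.out.one_lt.le
  have hn : ‖c / (p : ℚ_[p]) ^ c.valuation‖ = 1 := by
    rw [norm_div, Padic.norm_p_zpow, Padic.norm_eq_zpow_neg_valuation hc]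
    exact div_self (zpow_ne_zero _ (by exact_mod_cast hp.out.ne_zero))
  obtain ⟨u, hu⟩ : ∃ u : ℤ_[p], (u : ℚ_[p]) = c / (p : ℚ_[p]) ^ c.valuation :=
    ⟨⟨_, hn.le⟩, rfl⟩
  have hu1 : ‖u‖ = 1 := by rw [PadicInt.norm_def, hu, hn]
  have hcu : c = (p : ℚ_[p]) ^ c.valuation * u := by
    rw [hu]; field_simp
  have hpu : ‖(p : ℤ_[p]) * u‖ = 1 / p := by
    rw [norm_mul, hu1, PadicInt.norm_p, mul_one, one_div]
  rcases Int.even_or_odd' c.valuation with ⟨k, hk | hk⟩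
  · refine ⟨p ^ k, p ^ k, u, p * u, zpow_ne_zero _ hp0, zpow_ne_zero _ hp0, ?_, ?_, ?_, ?_,
      Or.inl hu1⟩
    · conv_lhs => rw [hcu, hk]
      rw [← zpow_natCast, ← zpow_mul, mul_comm k]; norm_cast
    · conv_lhs => rw [hcu, hk]
      rw [← zpow_natCast, ← zpow_mul, mul_comm k]; push_cast; ring
    · rw [hu1]; exact hp1
    · rw [hpu]
  · refine ⟨p ^ k, p ^ (k + 1), p * u, u, zpow_ne_zero _ hp0, zpow_ne_zero _ hp0, ?_, ?_, ?_, ?_,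
      Or.inr hu1⟩
    · conv_lhs => rw [hcu, hk, zpow_add₀ hp0, zpow_one]
      rw [← zpow_natCast, ← zpow_mul, mul_comm k]; push_cast; ring
    · conv_lhs => rw [hcu, hk, zpow_add₀ hp0, zpow_one]
      rw [zpow_add₀ hp0, zpow_one, mul_pow, ← zpow_natCast, ← zpow_mul, mul_comm k]; push_cast; ring
    · rw [hpu]
    · rw [hu1]; exact hp1

lemma aux_iso_of (c s : Fin 5 → ℚ_[p]) (l : ℚ_[p]) (hl : l ≠ 0) (d : Fin 5 → ℤ_[p])
    (hs : ∀ i, s i ≠ 0) (hc : ∀ i, l * c i = s i ^ 2 * d i)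
    (hd : ∀ i, 1 / (p : ℝ) ≤ ‖d i‖) (σ : Equiv.Perm (Fin 5)) (h0 : ‖d (σ 0)‖ = 1)
    (h1 : ‖d (σ 1)‖ = 1) (h2 : ‖d (σ 2)‖ = 1) :
    ∃ t : Fin 5 → ℚ_[p], t ≠ 0 ∧ ∑ i, c i * t i ^ 2 = 0 := by
  obtain ⟨y, hy, hsum⟩ := aux_iso3 (fun i => d (σ i)) h0 h1 h2 (fun i => hd _)
  refine ⟨fun i => y (σ.symm i) / s i, ?_, ?_⟩
  · intro h
    apply hy
    funext i
    have := congrFun h (σ i)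
    simpa [hs] using this
  · have e1 : ∀ i, c i * ((y (σ.symm i) : ℚ_[p]) / s i) ^ 2
        = l⁻¹ * (d i * y (σ.symm i) ^ 2) := by
      intro i
      have := hs i
      have hci : c i = l⁻¹ * (s i ^ 2 * d i) := by rw [← hc]; field_simp
      rw [hci]; field_simp
    simp only [e1]
    rw [← Finset.mul_sum, ← Equiv.sum_comp σ]
    simp only [Equiv.symm_apply_apply]
    have h3 : ((∑ j, d (σ j) * y j ^ 2 : ℤ_[p]) : ℚ_[p]) = 0 := by rw [hsum]; simp
    simp only [PadicInt.coe_sum, PadicInt.coe_mul, PadicInt.coe_pow] at h3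
    rw [h3, mul_zero]

lemma aux_iso (c : Fin 5 → ℚ_[p]) (hc : ∀ i, c i ≠ 0) :
    ∃ t : Fin 5 → ℚ_[p], t ≠ 0 ∧ ∑ i, c i * t i ^ 2 = 0 := by
  classical
  choose s s' d d' hs hs' h1 h2 h3 h4 h5 using fun i => aux_red (c i) (hc i)
  obtain ⟨σ, e1, e2⟩ := aux_pig (fun i => decide (‖d i‖ = 1))
  simp only [decide_eq_decide] at e1 e2
  by_cases h : ‖d (σ 0)‖ = 1
  · exact aux_iso_of c s 1 one_ne_zero d hs (by simpa using h1) h3 σ h (e1.1 h) (e2.1 (e1.1 h))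
  · have hh1 : ¬ ‖d (σ 1)‖ = 1 := fun hh => h (e1.2 hh)
    have hh2 : ¬ ‖d (σ 2)‖ = 1 := fun hh => hh1 (e2.2 hh)
    exact aux_iso_of c s' p (by exact_mod_cast hp.out.ne_zero) d' hs' h2 h4 σ
      ((h5 _).resolve_left h) ((h5 _).resolve_left hh1) ((h5 _).resolve_left hh2)

lemma aux_univ (c : Fin 4 → ℚ_[p]) (hc : ∀ i, c i ≠ 0) (N : ℚ_[p]) (hN : N ≠ 0) :
    ∃ t : Fin 4 → ℚ_[p], ∑ i, c i * t i ^ 2 = N := by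
  obtain ⟨t, ht, hsum⟩ := aux_iso (Fin.cons (-N) c) (by
    intro i
    refine Fin.cases ?_ (fun j => ?_) i
    · simpa using hN
    · simpa using hc j)
  rw [Fin.sum_univ_succ] at hsum
  simp only [Fin.cons_zero, Fin.cons_succ] at hsum
  by_cases h0 : t 0 = 0
  · obtain ⟨j, hj⟩ : ∃ j : Fin 4, t j.succ ≠ 0 := by
      by_contra hcon
      push Not at hcon
      apply ht
      funext i
      exact Fin.cases h0 hcon i
    have hq : ∑ i : Fin 4, c i * t i.succ ^ 2 = 0 := by simpa [h0] using hsum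
    -- vector `r t + e_j`
    have hcj := hc j
    obtain ⟨r, hr⟩ : ∃ r : ℚ_[p], 2 * r * (c j * t j.succ) + c j = N :=
      ⟨(N - c j) / (2 * (c j * t j.succ)), by field_simp; ring⟩
    refine ⟨fun i => r * t i.succ + (if i = j then 1 else 0), ?_⟩
    have e1 : ∀ i, c i * (r * t i.succ + (if i = j then 1 else 0)) ^ 2
        = r ^ 2 * (c i * t i.succ ^ 2)
          + (if i = j then 2 * r * (c i * t i.succ) + c i else 0) := by
      intro i; split_ifs <;> ring
    simp only [e1]
    rw [Finset.sum_add_distrib, ← Finset.mul_sum, hq]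
    simp [hr]
  · refine ⟨fun i => t i.succ / t 0, ?_⟩
    simp only [div_pow, mul_div_assoc']
    rw [← Finset.sum_div]
    field_simp
    linear_combination hsum

open Filter Topology in
lemma aux_nhd (c : Fin 4 → ℚ_[p]) (hc : ∀ i, c i ≠ 0) :
    ∃ ε : ℝ, 0 < ε ∧ ∀ N : ℚ_[p], ‖N‖ < ε →
      ∃ t : Fin 4 → ℚ_[p], (∀ i, ‖t i‖ ≤ 1) ∧ ∑ i, c i * t i ^ 2 = N := by
  have hpR : (0 : ℝ) < p := by exact_mod_cast hp.out.pos
  have hp0 : (p : ℚ_[p]) ≠ 0 := by exact_mod_cast hp.out.ne_zero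
  have hple : ‖(p : ℚ_[p])‖ ≤ 1 := Padic.norm_p_lt_one.le
  have hcomp : IsCompact (Metric.closedBall (0 : ℚ_[p]) 1 ∩ {M | 1 / (p : ℝ) ≤ ‖M‖}) :=
    (isCompact_closedBall _ _).inter_right (isClosed_le continuous_const continuous_norm)
  have hmono : ∀ (h k : ℕ), h ≤ k → ∀ M : ℚ_[p],
      (∃ t : Fin 4 → ℚ_[p], (∀ i, ‖t i‖ ≤ 1) ∧ ∑ i, c i * t i ^ 2 = p ^ (2 * h) * M) →
      (∃ t : Fin 4 → ℚ_[p], (∀ i, ‖t i‖ ≤ 1) ∧ ∑ i, c i * t i ^ 2 = p ^ (2 * k) * M) := by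
    rintro h k hk M ⟨t, ht, hs⟩
    obtain ⟨e, rfl⟩ := Nat.exists_eq_add_of_le hk
    refine ⟨fun i => p ^ e * t i, fun i => ?_, ?_⟩
    · rw [norm_mul, norm_pow]
      exact mul_le_one₀ (pow_le_one₀ (norm_nonneg _) hple) (norm_nonneg _) (ht i)
    · have : ∀ i, c i * (p ^ e * t i) ^ 2 = p ^ (2 * e) * (c i * t i ^ 2) := fun i => by ring
      simp only [this]
      rw [← Finset.mul_sum, hs]; ring
  obtain ⟨h, hh⟩ : ∃ h : ℕ, ∀ M ∈ Metric.closedBall (0 : ℚ_[p]) 1 ∩ {M | 1 / (p : ℝ) ≤ ‖M‖},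
      ∃ t : Fin 4 → ℚ_[p], (∀ i, ‖t i‖ ≤ 1) ∧ ∑ i, c i * t i ^ 2 = p ^ (2 * h) * M := by
    refine hcomp.induction_on (p := fun S => ∃ h : ℕ, ∀ M ∈ S,
      ∃ t : Fin 4 → ℚ_[p], (∀ i, ‖t i‖ ≤ 1) ∧ ∑ i, c i * t i ^ 2 = p ^ (2 * h) * M)
      ⟨0, by simp⟩ ?_ ?_ ?_
    · rintro S T hST ⟨h, hh⟩
      exact ⟨h, fun M hM => hh M (hST hM)⟩
    · rintro S T ⟨h, hh⟩ ⟨k, hk⟩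
      refine ⟨max h k, fun M hM => ?_⟩
      rcases hM with hM | hM
      · exact hmono _ _ (le_max_left _ _) _ (hh M hM)
      · exact hmono _ _ (le_max_right _ _) _ (hk M hM)
    · rintro M ⟨-, hM⟩
      have hM0 : M ≠ 0 := by
        rintro rfl
        simp at hM
        exact hp.out.ne_zero hM
      obtain ⟨t, ht⟩ := aux_univ c hc M hM0
      have hder : HasStrictDerivAt (fun z : ℚ_[p] => z ^ 2 * M) (2 * M) 1 := by
        have := ((hasStrictDerivAt_id (1 : ℚ_[p])).pow 2).mul_const M
        simpa using this
      have hmap := hder.map_nhds_eq (by simpa using hM0)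
      have hball : Metric.closedBall (0 : ℚ_[p]) 1 ∈ 𝓝 (1 : ℚ_[p]) :=
        (IsUltrametricDist.isOpen_closedBall _ one_ne_zero).mem_nhds (by simp)
      have him : (fun z : ℚ_[p] => z ^ 2 * M) '' Metric.closedBall (0 : ℚ_[p]) 1 ∈ 𝓝 M := by
        have := image_mem_map (f := 𝓝 (1 : ℚ_[p])) (m := fun z : ℚ_[p] => z ^ 2 * M) hball
        rw [hmap] at this
        simpa using this
      -- bounded denominators
      obtain ⟨e, he⟩ : ∃ e : ℕ, ∀ i, ‖(p : ℚ_[p]) ^ e * t i‖ ≤ 1 := by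
        have hlim : ∀ i, ∀ᶠ e : ℕ in atTop, ‖(p : ℚ_[p]) ^ e * t i‖ ≤ 1 := by
          intro i
          have h1 : Tendsto (fun e : ℕ => ‖(p : ℚ_[p])‖ ^ e * ‖t i‖) atTop (𝓝 (0 * ‖t i‖)) :=
            (tendsto_pow_atTop_nhds_zero_of_lt_one (norm_nonneg _)
              Padic.norm_p_lt_one).mul_const _
          rw [zero_mul] at h1
          filter_upwards [h1.eventually (eventually_le_nhds (zero_lt_one))] with e he
          rwa [norm_mul, norm_pow]
        exact (eventually_all.2 hlim).exists
      refine ⟨_, mem_nhdsWithin_of_mem_nhds him, e, ?_⟩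
      rintro _ ⟨z, hz, rfl⟩
      refine ⟨fun i => z * (p ^ e * t i), fun i => ?_, ?_⟩
      · rw [norm_mul]
        exact mul_le_one₀ (by simpa using hz) (norm_nonneg _) (he i)
      · have : ∀ i, c i * (z * (p ^ e * t i)) ^ 2 = (p ^ (2 * e) * z ^ 2) * (c i * t i ^ 2) :=
          fun i => by ring
        simp only [this]
        rw [← Finset.mul_sum, ht]; ring
  refine ⟨‖(p : ℚ_[p]) ^ h‖ ^ 2 / p, div_pos (pow_pos (norm_pos_iff.2 (pow_ne_zero _ hp0)) 2) hpR, fun N hN => ?_⟩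
  by_cases hN0 : N = 0
  · exact ⟨0, by simp, by simp [hN0]⟩
  obtain ⟨s, s', d, d', hs, -, hNs, -, hd, -, -⟩ := aux_red N hN0
  obtain ⟨t, ht, hsum⟩ := hh d ⟨by simpa using PadicInt.norm_le_one d, by simpa using hd⟩
  have hph : (p : ℚ_[p]) ^ h ≠ 0 := pow_ne_zero _ hp0
  have hsn : ‖s / (p : ℚ_[p]) ^ h‖ ≤ 1 := by
    rw [norm_div, div_le_one (norm_pos_iff.2 hph)]
    have h1 : ‖N‖ = ‖s‖ ^ 2 * ‖d‖ := by
      rw [hNs, norm_mul, norm_pow, PadicInt.norm_def]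
    have h2 : ‖s‖ ^ 2 * (1 / p) ≤ ‖N‖ := by
      rw [h1]; exact mul_le_mul_of_nonneg_left hd (by positivity)
    have h3 : ‖s‖ ^ 2 * (1 / p) < ‖(p : ℚ_[p]) ^ h‖ ^ 2 * (1 / p) := by
      calc _ ≤ _ := h2
        _ < _ := hN
        _ = _ := by ring
    have h4 : ‖s‖ ^ 2 < ‖(p : ℚ_[p]) ^ h‖ ^ 2 := lt_of_mul_lt_mul_right h3 (by positivity)
    exact (lt_of_pow_lt_pow_left₀ 2 (norm_nonneg _) h4).le
  refine ⟨fun i => s / p ^ h * t i, fun i => ?_, ?_⟩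
  · rw [norm_mul]
    exact mul_le_one₀ hsn (norm_nonneg _) (ht i)
  · have : ∀ i, c i * (s / p ^ h * t i) ^ 2 = (s / p ^ h) ^ 2 * (c i * t i ^ 2) :=
      fun i => by ring
    simp only [this]
    rw [← Finset.mul_sum, hsum, hNs]
    field_simp
    ring
end
section
lemma aux_w {R : Type*} [CommRing R] (k : ℕ) (a : Fin (k + 5) → R) (t : Fin 4 → R) :
    ∃ w : Fin (k + 5) → R, ∑ i, a i * w i = 0 ∧ ∑ i, a i * w i ^ 2 =
      a 1 * a 0 * (a 0 + a 1) * t 0 ^ 2 + a 2 * (a 0 + a 1) * (a 0 + a 1 + a 2) * t 1 ^ 2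
      + a 3 * (a 0 + a 1 + a 2) * (a 0 + a 1 + a 2 + a 3) * t 2 ^ 2
      + a 4 * (a 0 + a 1 + a 2 + a 3) * (a 0 + a 1 + a 2 + a 3 + a 4) * t 3 ^ 2 := by
  have h1 : (1 : Fin (k + 5)) = Fin.succ 0 := rfl
  have h2 : (2 : Fin (k + 5)) = Fin.succ (Fin.succ 0) := rfl
  have h3 : (3 : Fin (k + 5)) = Fin.succ (Fin.succ (Fin.succ 0)) := rfl
  have h4 : (4 : Fin (k + 5)) = Fin.succ (Fin.succ (Fin.succ (Fin.succ 0))) := rfl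
  rw [h1, h2, h3, h4]
  generalize e0 : a 0 = a0
  generalize e1 : a (Fin.succ 0) = a1
  generalize e2 : a (Fin.succ (Fin.succ 0)) = a2
  generalize e3 : a (Fin.succ (Fin.succ (Fin.succ 0))) = a3
  generalize e4 : a (Fin.succ (Fin.succ (Fin.succ (Fin.succ 0)))) = a4
  refine ⟨Fin.cons (a1 * t 0 + a2 * t 1 + a3 * t 2 + a4 * t 3)
    (Fin.cons (- a0 * t 0 + a2 * t 1 + a3 * t 2 + a4 * t 3)
    (Fin.cons (- (a0 + a1) * t 1 + a3 * t 2 + a4 * t 3)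
    (Fin.cons (- (a0 + a1 + a2) * t 2 + a4 * t 3)
    (Fin.cons (- (a0 + a1 + a2 + a3) * t 3) (fun _ => 0))))), ?_, ?_⟩
  · rw [Fin.sum_univ_succ, Fin.sum_univ_succ, Fin.sum_univ_succ, Fin.sum_univ_succ,
      Fin.sum_univ_succ]
    simp only [Fin.cons_zero, Fin.cons_succ, e0, e1, e2, e3, e4, mul_zero, Finset.sum_const_zero]
    ring
  · rw [Fin.sum_univ_succ, Fin.sum_univ_succ, Fin.sum_univ_succ, Fin.sum_univ_succ,
      Fin.sum_univ_succ]
    simp only [Fin.cons_zero, Fin.cons_succ, e0, e1, e2, e3, e4, mul_zero, Finset.sum_const_zero,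
      zero_pow two_ne_zero]
    ring

lemma aux_shift {R ι : Type*} [CommRing R] [Fintype ι] (a w : ι → R) (z : R)
    (hw : ∑ i, a i * w i = 0) :
    ∑ i, a i * (z + w i) = z * ∑ i, a i ∧
    ∑ i, a i * (z + w i) ^ 2 = z ^ 2 * ∑ i, a i + ∑ i, a i * w i ^ 2 := by
  constructor
  · have : ∀ i, a i * (z + w i) = z * a i + a i * w i := fun i => by ring
    simp only [this, Finset.sum_add_distrib, ← Finset.mul_sum, hw, add_zero]
  · have : ∀ i, a i * (z + w i) ^ 2 = z ^ 2 * a i + 2 * z * (a i * w i) + a i * w i ^ 2 :=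
      fun i => by ring
    simp only [this, Finset.sum_add_distrib, ← Finset.mul_sum, hw, add_zero, mul_zero]

variable {p : ℕ} [hp : Fact p.Prime]

lemma aux_goodp (k : ℕ) (a : Fin (k + 5) → ℤ) (hp2 : p ≠ 2) (hS : ‖((∑ i, a i : ℤ) : ℤ_[p])‖ = 1)
    (h1 : ‖((a 1 * a 0 * (a 0 + a 1) : ℤ) : ℤ_[p])‖ = 1)
    (h2 : ‖((a 2 * (a 0 + a 1) * (a 0 + a 1 + a 2) : ℤ) : ℤ_[p])‖ = 1)
    (h3 : ‖((a 3 * (a 0 + a 1 + a 2) * (a 0 + a 1 + a 2 + a 3) : ℤ) : ℤ_[p])‖ = 1) (C D : ℤ_[p]) :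
    ∃ x : Fin (k + 5) → ℤ_[p], ∑ i, (a i : ℤ_[p]) * x i = C ∧
      ∑ i, (a i : ℤ_[p]) * x i ^ 2 = D := by
  obtain ⟨T, hT⟩ := (PadicInt.isUnit_iff.2 hS).exists_right_inv
  obtain ⟨x, y, z, hxyz⟩ := aux_good hp2 _ _ _ (D - C ^ 2 * T) h1 h2 h3
  obtain ⟨w, hw1, hw2⟩ := aux_w k (fun i => (a i : ℤ_[p])) ![x, y, z, 0]
  obtain ⟨e1, e2⟩ := aux_shift _ w (C * T) hw1
  refine ⟨fun i => C * T + w i, ?_, ?_⟩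
  · rw [e1]
    push_cast at hT
    linear_combination C * hT
  · rw [e2, hw2]
    simp only [Matrix.cons_val]
    push_cast at hT hxyz
    linear_combination C ^ 2 * T * hT + hxyz

lemma aux_deriv {ι : Type*} [Fintype ι] (α x : ι → ℚ_[p]) :
    HasStrictFDerivAt (fun x : ι → ℚ_[p] => (∑ i, α i * x i, ∑ i, α i * x i ^ 2))
      ((∑ i, α i • ContinuousLinearMap.proj (R := ℚ_[p]) (φ := fun _ : ι => ℚ_[p]) i).prod
       (∑ i, (α i * (2 * x i)) • ContinuousLinearMap.proj (R := ℚ_[p]) (φ := fun _ : ι => ℚ_[p]) i))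
      x := by
  refine HasStrictFDerivAt.prodMk ?_ ?_
  · refine HasStrictFDerivAt.fun_sum fun i _ => ?_
    exact (ContinuousLinearMap.hasStrictFDerivAt
      (ContinuousLinearMap.proj (R := ℚ_[p]) (φ := fun _ : ι => ℚ_[p]) i)).const_mul (α i)
  · refine HasStrictFDerivAt.fun_sum fun i _ => ?_
    have := ((ContinuousLinearMap.hasStrictFDerivAt (x := x)
      (ContinuousLinearMap.proj (R := ℚ_[p]) (φ := fun _ : ι => ℚ_[p]) i)).pow 2).const_mul (α i)
    refine this.congr_fderiv ?_
    ext v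
    simp
    ring

open Filter Topology in
lemma aux_open (k : ℕ) (a : Fin (k + 5) → ℤ) (ha : ∀ i, 0 < a i) :
    IsOpen ((fun x : Fin (k + 5) → ℚ_[p] =>
      (∑ i, (a i : ℚ_[p]) * x i, ∑ i, (a i : ℚ_[p]) * x i ^ 2)) ''
        (Set.univ.pi fun _ => Metric.closedBall (0 : ℚ_[p]) 1)) := by
  have hα : ∀ i, (a i : ℚ_[p]) ≠ 0 := fun i => by exact_mod_cast (ha i).ne'
  have hSpos : 0 < ∑ i, a i := Finset.sum_pos (fun i _ => ha i) Finset.univ_nonempty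
  have hS : (∑ i, (a i : ℚ_[p])) ≠ 0 := by exact_mod_cast hSpos.ne'
  have hopen : IsOpen (Set.univ.pi fun _ : Fin (k + 5) => Metric.closedBall (0 : ℚ_[p]) 1) :=
    isOpen_set_pi Set.finite_univ
      (fun _ _ => IsUltrametricDist.isOpen_closedBall _ one_ne_zero)
  rw [isOpen_iff_mem_nhds]
  rintro _ ⟨x, hx, rfl⟩
  by_cases hsing : ∃ j, x j ≠ x 0
  · obtain ⟨j, hj⟩ := hsing
    have hj0 : j ≠ 0 := by rintro rfl; exact hj rfl
    have hmap := (aux_deriv (fun i => (a i : ℚ_[p])) x).map_nhds_eq_of_surj (by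
      rw [LinearMap.range_eq_top]
      rintro ⟨u, v⟩
      have hd : x 0 - x j ≠ 0 := sub_ne_zero.2 (Ne.symm hj)
      have h0 := hα 0
      have hj' := hα j
      obtain ⟨δ, hδ⟩ : ∃ δ, δ = u / ∑ i, (a i : ℚ_[p]) := ⟨_, rfl⟩
      obtain ⟨s, hs⟩ : ∃ s, s * (2 * (a 0 * a j * (x 0 - x j)))
          = v - δ * (2 * ∑ i, (a i : ℚ_[p]) * x i) :=
        ⟨(v - δ * (2 * ∑ i, (a i : ℚ_[p]) * x i)) / (2 * (a 0 * a j * (x 0 - x j))), by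
          field_simp⟩
      refine ⟨fun i => δ + ((if i = 0 then s * a j else 0) - (if i = j then s * a 0 else 0)), ?_⟩
      simp [mul_add, mul_sub, Finset.sum_add_distrib, Finset.sum_sub_distrib]
      constructor
      · rw [← Finset.sum_mul, hδ]
        field_simp
        ring
      · have : ∑ i, (a i : ℚ_[p]) * (2 * x i) * δ = δ * (2 * ∑ i, (a i : ℚ_[p]) * x i) := by
          rw [Finset.mul_sum, Finset.mul_sum]
          exact Finset.sum_congr rfl fun i _ => by ring
        rw [this]
        linear_combination hs)
    have := image_mem_map (m := (fun x : Fin (k + 5) → ℚ_[p] =>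
      (∑ i, (a i : ℚ_[p]) * x i, ∑ i, (a i : ℚ_[p]) * x i ^ 2))) (hopen.mem_nhds hx)
    rw [hmap] at this
    exact this
  · push Not at hsing
    obtain ⟨c, hc⟩ : ∃ c, c = x 0 := ⟨_, rfl⟩
    have hxc : x = fun _ => c := funext fun j => by rw [hsing j, hc]
    have hcn : ‖c‖ ≤ 1 := by
      have := hx 0 (Set.mem_univ _)
      rw [hc]; simpa using this
    subst hxc
    obtain ⟨ε, hε, hN⟩ := aux_nhd (p := p) ![a 1 * a 0 * (a 0 + a 1),
      a 2 * (a 0 + a 1) * (a 0 + a 1 + a 2),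
      a 3 * (a 0 + a 1 + a 2) * (a 0 + a 1 + a 2 + a 3),
      a 4 * (a 0 + a 1 + a 2 + a 3) * (a 0 + a 1 + a 2 + a 3 + a 4)] (by
        have h0 := ha 0
        have h1 := ha 1
        have h2 := ha 2
        have h3 := ha 3
        have h4 := ha 4
        intro i
        fin_cases i
        · have : 0 < a 1 * a 0 * (a 0 + a 1) := by positivity
          have h : ((_ : ℤ) : ℚ_[p]) ≠ 0 := Int.cast_ne_zero.2 this.ne'
          push_cast at h
          exact h
        · have : 0 < a 2 * (a 0 + a 1) * (a 0 + a 1 + a 2) := by positivity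
          have h : ((_ : ℤ) : ℚ_[p]) ≠ 0 := Int.cast_ne_zero.2 this.ne'
          push_cast at h
          exact h
        · have : 0 < a 3 * (a 0 + a 1 + a 2) * (a 0 + a 1 + a 2 + a 3) := by positivity
          have h : ((_ : ℤ) : ℚ_[p]) ≠ 0 := Int.cast_ne_zero.2 this.ne'
          push_cast at h
          exact h
        · have : 0 < a 4 * (a 0 + a 1 + a 2 + a 3) * (a 0 + a 1 + a 2 + a 3 + a 4) := by
            positivity
          have h : ((_ : ℤ) : ℚ_[p]) ≠ 0 := Int.cast_ne_zero.2 this.ne'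
          push_cast at h
          exact h)
    obtain ⟨S, hSS⟩ : ∃ S, S = ∑ i, (a i : ℚ_[p]) := ⟨_, rfl⟩
    rw [← hSS] at hS
    simp only [← Finset.sum_mul, ← hSS]
    have t1 : Tendsto (fun q : ℚ_[p] × ℚ_[p] => q.1 / S) (𝓝 (S * c, S * c ^ 2)) (𝓝 c) := by
      have : Continuous (fun q : ℚ_[p] × ℚ_[p] => q.1 / S) := by fun_prop
      convert this.tendsto _ using 2
      simp only
      field_simp
    have t2 : Tendsto (fun q : ℚ_[p] × ℚ_[p] => q.2 - q.1 ^ 2 / S) (𝓝 (S * c, S * c ^ 2))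
        (𝓝 0) := by
      have : Continuous (fun q : ℚ_[p] × ℚ_[p] => q.2 - q.1 ^ 2 / S) := by fun_prop
      convert this.tendsto _ using 2
      simp only
      field_simp
      ring
    have hb1 : Metric.closedBall (0 : ℚ_[p]) 1 ∈ 𝓝 c :=
      (IsUltrametricDist.isOpen_closedBall _ one_ne_zero).mem_nhds (by simpa using hcn)
    filter_upwards [t1 hb1, t2 (Metric.ball_mem_nhds 0 hε)] with q hq1 hq2
    obtain ⟨t, ht, hsum⟩ := hN (q.2 - q.1 ^ 2 / S) (by simpa using hq2)
    obtain ⟨w, hw1, hw2⟩ := aux_w k (fun i => (a i : ℤ_[p])) (fun i => ⟨t i, ht i⟩)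
    have hw1' : ∑ i, (a i : ℚ_[p]) * (w i : ℚ_[p]) = 0 := by
      have := congrArg (PadicInt.Coe.ringHom (p := p)) hw1
      simp only [map_sum, map_mul, map_intCast, map_zero] at this
      exact this
    have hw2' := congrArg (PadicInt.Coe.ringHom (p := p)) hw2
    simp only [map_sum, map_mul, map_pow, map_add, map_intCast] at hw2'
    obtain ⟨e1, e2⟩ := aux_shift _ (fun i => (w i : ℚ_[p])) (q.1 / S) hw1'
    refine ⟨fun i => q.1 / S + (w i : ℚ_[p]), ?_, ?_⟩
    · intro i _
      rw [mem_closedBall_zero_iff]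
      refine (Padic.nonarchimedean _ _).trans (max_le (by simpa using hq1) ?_)
      exact (w i).2
    · refine Prod.ext ?_ ?_
      · simp only
        rw [e1, ← hSS]
        field_simp
      · simp only
        rw [e2, ← hSS]
        rw [Fin.sum_univ_four] at hsum
        simp only [Matrix.cons_val] at hsum
        have e3 : ∑ i, (a i : ℚ_[p]) * (w i : ℚ_[p]) ^ 2 = q.2 - q.1 ^ 2 / S :=
          hw2'.trans hsum
        rw [e3]
        field_simp
        ring

lemma aux_bad (p : ℕ) [hp : Fact p.Prime] (k : ℕ) (a : Fin (k + 5) → ℤ) (ha : ∀ i, 0 < a i) :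
    ∃ e : ℕ, ∀ (x : Fin (k + 5) → ℤ) (C D : ℤ), (p : ℤ) ^ e ∣ C - ∑ i, a i * x i →
      (p : ℤ) ^ e ∣ D - ∑ i, a i * x i ^ 2 →
      ∃ x' : Fin (k + 5) → ℤ_[p], ∑ i, (a i : ℤ_[p]) * x' i = C ∧
        ∑ i, (a i : ℤ_[p]) * x' i ^ 2 = D := by
  have hcomp : IsCompact ((fun x : Fin (k + 5) → ℚ_[p] =>
      (∑ i, (a i : ℚ_[p]) * x i, ∑ i, (a i : ℚ_[p]) * x i ^ 2)) ''
        (Set.univ.pi fun _ => Metric.closedBall (0 : ℚ_[p]) 1)) :=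
    (isCompact_univ_pi fun _ => isCompact_closedBall _ _).image (by fun_prop)
  obtain ⟨δ, hδ, hsub⟩ := hcomp.exists_thickening_subset_open (aux_open k a ha) subset_rfl
  obtain ⟨e, he⟩ := exists_pow_lt_of_lt_one hδ (Padic.norm_p_lt_one (p := p))
  refine ⟨e, fun x C D hC hD => ?_⟩
  have hn : ∀ z : ℤ, (p : ℤ) ^ e ∣ z → ‖(z : ℚ_[p])‖ < δ := by
    rintro _ ⟨z, rfl⟩
    push_cast
    rw [norm_mul, norm_pow]
    refine lt_of_le_of_lt ?_ he
    exact mul_le_of_le_one_right (by positivity) (Padic.norm_int_le_one z)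
  have hmem : ((C : ℚ_[p]), (D : ℚ_[p])) ∈ Metric.thickening δ ((fun x : Fin (k + 5) → ℚ_[p] =>
      (∑ i, (a i : ℚ_[p]) * x i, ∑ i, (a i : ℚ_[p]) * x i ^ 2)) ''
        (Set.univ.pi fun _ => Metric.closedBall (0 : ℚ_[p]) 1)) := by
    rw [Metric.mem_thickening_iff]
    refine ⟨_, ⟨fun i => (x i : ℚ_[p]), ?_, rfl⟩, ?_⟩
    · intro i _
      simpa using Padic.norm_int_le_one (x i)
    · rw [Prod.dist_eq, max_lt_iff]
      have h1 := hn _ hC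
      have h2 := hn _ hD
      push_cast at h1 h2
      exact ⟨by rw [dist_eq_norm]; exact h1, by rw [dist_eq_norm]; exact h2⟩
  obtain ⟨y, hy, hyy⟩ := hsub hmem
  have hy' : ∀ i, ‖y i‖ ≤ 1 := fun i => by simpa using hy i (Set.mem_univ _)
  have hy1 := congrArg Prod.fst hyy
  have hy2 := congrArg Prod.snd hyy
  simp only at hy1 hy2
  obtain ⟨Y, hY⟩ : ∃ Y : Fin (k + 5) → ℤ_[p], ∀ i, (Y i : ℚ_[p]) = y i :=
    ⟨fun i => ⟨y i, hy' i⟩, fun i => rfl⟩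
  simp only [← hY] at hy1 hy2
  refine ⟨Y, ?_, ?_⟩
  · apply PadicInt.ext
    simpa [PadicInt.coe_sum] using hy1
  · apply PadicInt.ext
    simpa [PadicInt.coe_sum] using hy2

lemma aux_norm_one (z : ℤ) (h : ¬ (p : ℤ) ∣ z) : ‖(z : ℤ_[p])‖ = 1 := by
  by_contra hne
  exact h ((PadicInt.norm_int_lt_one_iff_dvd z).1 (lt_of_le_of_ne (PadicInt.norm_le_one _) hne))

lemma aux_polyNum (m x : ℤ) : ∃ q : ℤ, x ^ 2 = 2 * q + x ∧ polyNum m x = (m - 2) * q + x := by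
  obtain ⟨q, hq⟩ : (2 : ℤ) ∣ x * (x - 1) := (Int.even_mul_pred_self x).two_dvd
  refine ⟨q, by linear_combination hq, ?_⟩
  unfold polyNum
  rw [hq, show (m - 2) * (2 * q) = 2 * ((m - 2) * q) by ring, Int.mul_ediv_cancel_left _ two_ne_zero]

end
/-- key lemma: coefficients are `a 0, a 1, …, a n` with `n + 1 ≥ 5` (so `a 0`
plays the role of `a₁` in the paper and `a i.succ` those of `a₂, …, aₙ`).  There is `K > 0`
depending only on the coefficients such that whenever `A(m-2)+B` (with `0 ≤ B ≤ m-3`) is locally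
represented by the form, there is a residue class `k₀ (mod K)` such that for every `k' ≡ k₀
(mod K)` and every prime `p`, the quadratic equation
`(B + k'(m-2) - Σᵢ≥₁ aᵢyᵢ)² + Σᵢ≥₁ a₀aᵢyᵢ² = (2A+B+k'(m-4))·a₀` is solvable over `ℤ_p`. -/
theorem stmt14 (n : ℕ) (hn : 4 ≤ n) (a : Fin (n + 1) → ℤ) (ha : ∀ i, 0 < a i) :
    ∃ K : ℕ, 0 < K ∧
      ∀ m : ℤ, 3 ≤ m → ∀ A B : ℤ, 0 ≤ A → 0 ≤ B → B ≤ m - 3 →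
        (∀ r : ℤ, 0 < r →
          ∃ x : Fin (n + 1) → ℤ,
            (∑ i, a i * polyNum m (x i)) ≡ A * (m - 2) + B [ZMOD r]) →
        ∃ k₀ : ℤ, ∀ k' : ℤ, k' ≡ k₀ [ZMOD (K : ℤ)] →
          ∀ (p : ℕ) [Fact p.Prime],
            ∃ y : Fin n → ℤ_[p],
              (((B + k' * (m - 2) : ℤ) : ℤ_[p]) - ∑ i, (a i.succ : ℤ_[p]) * y i) ^ 2
                  + ∑ i, ((a 0 * a i.succ : ℤ) : ℤ_[p]) * (y i) ^ 2
                = (((2 * A + B + k' * (m - 4)) * a 0 : ℤ) : ℤ_[p]) := by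
  obtain ⟨k, rfl⟩ : ∃ k, n = k + 4 := ⟨n - 4, by omega⟩
  have hS : 0 < ∑ i, a i := Finset.sum_pos (fun i _ => ha i) Finset.univ_nonempty
  obtain ⟨M, hM⟩ : ∃ M : ℤ, M = 2 * (∑ i, a i) * (a 1 * a 0 * (a 0 + a 1))
    * (a 2 * (a 0 + a 1) * (a 0 + a 1 + a 2))
    * (a 3 * (a 0 + a 1 + a 2) * (a 0 + a 1 + a 2 + a 3)) := ⟨_, rfl⟩
  have hMpos : 0 < M := by
    have h0 := ha 0
    have h1 := ha 1
    have h2 := ha 2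
    have h3 := ha 3
    rw [hM]; positivity
  have hex : ∀ p : ℕ, ∃ e : ℕ, ∀ [Fact p.Prime], ∀ (x : Fin (k + 5) → ℤ) (C D : ℤ),
      (p : ℤ) ^ e ∣ C - ∑ i, a i * x i → (p : ℤ) ^ e ∣ D - ∑ i, a i * x i ^ 2 →
      ∃ x' : Fin (k + 5) → ℤ_[p], ∑ i, (a i : ℤ_[p]) * x' i = C ∧
        ∑ i, (a i : ℤ_[p]) * x' i ^ 2 = D := by
    intro p
    by_cases hp : p.Prime
    · have : Fact p.Prime := ⟨hp⟩
      obtain ⟨e, he⟩ := aux_bad p k a ha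
      exact ⟨e, fun x C D => he x C D⟩
    · exact ⟨0, fun {h} => absurd h.out hp⟩
  choose e he using hex
  have hKpos : 0 < ∏ p ∈ M.natAbs.primeFactors, p ^ e p :=
    Finset.prod_pos fun p hp => pow_pos (Nat.prime_of_mem_primeFactors hp).pos _
  refine ⟨∏ p ∈ M.natAbs.primeFactors, p ^ e p, hKpos, ?_⟩
  obtain ⟨K, hK⟩ : ∃ K : ℕ, K = ∏ p ∈ M.natAbs.primeFactors, p ^ e p := ⟨_, rfl⟩
  rw [← hK] at hKpos ⊢
  intro m hm A B hA hB hBm hloc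
  obtain ⟨x, hx⟩ := hloc K (by exact_mod_cast hKpos)
  choose q hq1 hq2 using fun i => aux_polyNum m (x i)
  have e1 : ∑ i, a i * polyNum m (x i) = (m - 2) * ∑ i, a i * q i + ∑ i, a i * x i := by
    rw [Finset.mul_sum, ← Finset.sum_add_distrib]
    exact Finset.sum_congr rfl fun i _ => by rw [hq2]; ring
  have e2 : ∑ i, a i * x i ^ 2 = 2 * ∑ i, a i * q i + ∑ i, a i * x i := by
    rw [Finset.mul_sum, ← Finset.sum_add_distrib]
    exact Finset.sum_congr rfl fun i _ => by rw [hq1]; ring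
  rw [e1] at hx
  obtain ⟨r, hr⟩ := hx.dvd
  refine ⟨A - ∑ i, a i * q i, fun k' hk' p hp => ?_⟩
  obtain ⟨s, hs⟩ := hk'.symm.dvd
  obtain ⟨x', hx1, hx2⟩ : ∃ x' : Fin (k + 5) → ℤ_[p],
      ∑ i, (a i : ℤ_[p]) * x' i = ((B + k' * (m - 2) : ℤ) : ℤ_[p]) ∧
        ∑ i, (a i : ℤ_[p]) * x' i ^ 2 = ((2 * A + B + k' * (m - 4) : ℤ) : ℤ_[p]) := by
    by_cases hpM : (p : ℤ) ∣ M
    · have hpK : (p : ℤ) ^ e p ∣ (K : ℤ) := by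
        have : p ^ e p ∣ K := by
          rw [hK]
          apply Finset.dvd_prod_of_mem (fun p => p ^ e p)
          rw [Nat.mem_primeFactors]
          exact ⟨hp.out, Int.natCast_dvd.1 hpM, by omega⟩
        exact_mod_cast this
      refine he p x _ _ (hpK.trans ⟨r + s * (m - 2), ?_⟩) (hpK.trans ⟨r + s * (m - 4), ?_⟩)
      · linear_combination hr + (m - 2) * hs
      · rw [e2]
        linear_combination hr + (m - 4) * hs
    · have hnd : ∀ z : ℤ, z ∣ M → ¬ (p : ℤ) ∣ z := fun z hz h => hpM (h.trans hz)
      refine aux_goodp k a ?_ (aux_norm_one _ (hnd _ ?_)) (aux_norm_one _ (hnd _ ?_))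
        (aux_norm_one _ (hnd _ ?_)) (aux_norm_one _ (hnd _ ?_)) _ _
      · rintro rfl
        exact hnd 2 (by rw [hM]; exact (((Dvd.intro _ rfl).mul_right _).mul_right _).mul_right _) (by norm_num)
      · rw [hM]; exact (((Dvd.intro_left _ rfl).mul_right _).mul_right _).mul_right _
      · rw [hM]; exact ((Dvd.intro_left _ rfl).mul_right _).mul_right _
      · rw [hM]; exact (Dvd.intro_left _ rfl).mul_right _
      · rw [hM]; exact Dvd.intro_left _ rfl
  rw [Fin.sum_univ_succ] at hx1 hx2
  refine ⟨fun i => x' i.succ, ?_⟩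
  have e3 : ∑ i : Fin (k + 4), ((a 0 * a i.succ : ℤ) : ℤ_[p]) * (x' i.succ) ^ 2
      = a 0 * ∑ i : Fin (k + 4), (a i.succ : ℤ_[p]) * (x' i.succ) ^ 2 := by
    rw [Finset.mul_sum]
    exact Finset.sum_congr rfl fun i _ => by push_cast; ring
  rw [e3, ← hx1, Int.cast_mul, ← hx2]
  ring
end
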